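/- arXiv:2605.09587 — 6 statements merged into one kernel-verified Lean document; each statement's English description precedes it below -/
import Mathlib

section
/- Let I ⊆ ℝ be an open interval and let x, y, r : I → ℝ be smooth functions with r(s) > 0 for all s ∈ I and x'(s)² + y'(s)² + r'(s)² = 1 on I. Define a = x'' + (r'/r)·x', b = y'' + (r'/r)·y', and c = r'' + (r'² − 1)/r on I. If a'' + (r'/r)·a' = 0, b'' + (r'/r)·b' = 0, and c'' + (r'/r)·c' − c/r² = 0 hold on I, then a, b, and c vanish identically on I. -/
open Set

namespace Biharm
open Polynomial Filter Topology

def fR {R : Type*} [CommRing R] (c d N μ Λ x : R) : R :=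
  -2 * (2 * N * x ^ 2 + 10 * μ * x + Λ) * (d + c * x) * (3 * μ + 2 * N * x)
    + (4 * d * x + 4 * c) * (3 * μ + 2 * N * x) ^ 2 + 8 * c * N * (d + c * x) ^ 2

def gR {R : Type*} [CommRing R] (c d N μ L m M W x : R) : R :=
  L * c ^ 2 * x ^ 2 * (3 * μ + 2 * N * x) ^ 2
    - 2 * m * c * x * (2 * N * d * x ^ 2 + 3 * μ * d * x + 3 * μ * c - 2 * N * d)
      * (3 * μ + 2 * N * x)
    + M * (2 * N * d * x ^ 2 + 3 * μ * d * x + 3 * μ * c - 2 * N * d) ^ 2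
    - W * (1 - x ^ 2) * (3 * μ + 2 * N * x) ^ 2

lemma map_fR {R S : Type*} [CommRing R] [CommRing S] (φ : R →+* S) (c d N μ Λ x : R) :
    φ (fR c d N μ Λ x) = fR (φ c) (φ d) (φ N) (φ μ) (φ Λ) (φ x) := by
  have h2 := map_ofNat φ 2
  have h3 := map_ofNat φ 3
  have h4 := map_ofNat φ 4
  have h8 := map_ofNat φ 8
  have h10 := map_ofNat φ 10
  simp [fR, h2, h3, h4, h8, h10]

lemma map_gR {R S : Type*} [CommRing R] [CommRing S] (φ : R →+* S) (c d N μ L m M W x : R) :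
    φ (gR c d N μ L m M W x) =
      gR (φ c) (φ d) (φ N) (φ μ) (φ L) (φ m) (φ M) (φ W) (φ x) := by
  have h2 := map_ofNat φ 2
  have h3 := map_ofNat φ 3
  simp [gR, h2, h3]

lemma deg_fR {R : Type*} [CommRing R] (c d N μ Λ : R) :
    (fR (C c) (C d) (C N) (C μ) (C Λ) X : R[X]).natDegree ≤ 4 := by
  unfold fR
  compute_degree

lemma deg_gR {R : Type*} [CommRing R] (c d N μ L m M W : R) :
    (gR (C c) (C d) (C N) (C μ) (C L) (C m) (C M) (C W) X : R[X]).natDegree ≤ 4 := by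
  unfold gR
  compute_degree

lemma tend_aux (P : ℝ[X][X]) :
    Tendsto (fun t : ℝ => Real.exp (-2 * t) * P.evalEval t (Real.exp (-2 * t))) atTop (𝓝 0) := by
  induction P using Polynomial.induction_on' with
  | add p q hp hq =>
    simpa [mul_add] using hp.add hq
  | monomial n p =>
    have h1 := Polynomial.tendsto_div_exp_atTop p
    have h2 : Tendsto (fun t : ℝ => Real.exp (-((2 * n + 1) * t))) atTop (𝓝 0) := by
      apply Real.tendsto_exp_neg_atTop_nhds_zero.comp
      exact tendsto_id.const_mul_atTop (by positivity)
    have h3 := h1.mul h2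
    rw [zero_mul] at h3
    refine h3.congr fun t => ?_
    simp only [Polynomial.evalEval, Polynomial.eval_monomial, Polynomial.eval_mul,
      Polynomial.eval_pow, Polynomial.eval_C]
    rw [← Real.exp_nat_mul, div_eq_mul_inv, ← Real.exp_neg, mul_assoc, ← Real.exp_add,
      mul_left_comm, ← Real.exp_add]
    congr 2
    ring

lemma analytic_aux (P : ℝ[X][X]) :
    AnalyticOnNhd ℝ (fun t : ℝ => P.evalEval t (Real.exp (-2 * t))) univ := by
  induction P using Polynomial.induction_on' with
  | add p q hp hq =>
    have h := hp.add hq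
    refine h.congr isOpen_univ fun t _ => ?_
    simp
  | monomial n p =>
    have h2 : AnalyticOnNhd ℝ (fun t : ℝ => p.eval t * (Real.exp (-2 * t)) ^ n) univ := by
      apply AnalyticOnNhd.mul
      · exact AnalyticOnNhd.eval_polynomial p
      · intro t _
        fun_prop
    simpa [Polynomial.evalEval] using h2

lemma coeff_zero_of_freq (P : ℝ[X][X]) (t0 : ℝ)
    (h : ∃ᶠ t in 𝓝[≠] t0, P.evalEval t (Real.exp (-2 * t)) = 0) (t : ℝ) :
    P.evalEval t 0 = 0 := by
  have h0 := (analytic_aux P).eqOn_zero_of_preconnected_of_frequently_eq_zero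
    isPreconnected_univ (mem_univ t0) h
  have e : ∀ t : ℝ, (P.coeff 0).eval t
      = -(Real.exp (-2 * t) * P.divX.evalEval t (Real.exp (-2 * t))) := by
    intro t
    have h1 := h0 (mem_univ t)
    simp only [Pi.zero_apply] at h1
    rw [← P.divX_mul_X_add] at h1
    simp only [evalEval_add, evalEval_mul, evalEval_X, evalEval_C] at h1
    linarith
  have h2 : Tendsto (fun t : ℝ => (P.coeff 0).eval t) atTop (𝓝 0) := by
    have := (tend_aux P.divX).neg
    rw [neg_zero] at this
    exact this.congr fun t => (e t).symm
  rw [Polynomial.tendsto_nhds_iff] at h2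
  have h3 : P.coeff 0 = 0 := by simpa using h2.1
  rw [← P.divX_mul_X_add, h3]
  simp

lemma key (A A0 B B0 c1 d1 : ℝ) (hc : c1 ≠ 0) (hL : A ^ 2 + B ^ 2 ≠ 0) (t0 : ℝ)
    (h : ∃ᶠ t in 𝓝[≠] t0, ∃ a b c d ρ : ℝ, a = A * t + A0 ∧ b = B * t + B0 ∧
      c = c1 * Real.exp t + d1 * Real.exp (-t) ∧ d = c1 * Real.exp t - d1 * Real.exp (-t) ∧
      fR c d (a ^ 2 + b ^ 2 + c ^ 2) (a * A + b * B + c * d)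
        (3 * (A ^ 2 + B ^ 2 + d ^ 2 + c ^ 2) + 2 * (a ^ 2 + b ^ 2 + c ^ 2) + 2 * c ^ 2) ρ = 0 ∧
      gR c d (a ^ 2 + b ^ 2 + c ^ 2) (a * A + b * B + c * d) (A ^ 2 + B ^ 2) (a * A + b * B)
        (a ^ 2 + b ^ 2) ((a * B - b * A) ^ 2) ρ = 0) : False := by
  let k : ℝ → ℝ[X][X] := fun z => C (C z)
  let e : ℝ[X][X] := X
  let t : ℝ[X][X] := C X
  let a := k A * t + k A0
  let b := k B * t + k B0
  let c := k c1 + k d1 * e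
  let d := k c1 - k d1 * e
  let N := e * (a ^ 2 + b ^ 2) + c ^ 2
  let μ := e * (a * k A + b * k B) + c * d
  let Λ := 3 * (e * (k A ^ 2 + k B ^ 2) + d ^ 2 + c ^ 2) + 2 * N + 2 * c ^ 2
  let L := k A ^ 2 + k B ^ 2
  let m := a * k A + b * k B
  let M := a ^ 2 + b ^ 2
  let W := e * (a * k B - b * k A) ^ 2
  let f : ℝ[X][X][X] := fR (C c) (C d) (C N) (C μ) (C Λ) X
  let g : ℝ[X][X][X] := gR (C c) (C d) (C N) (C μ) (C L) (C m) (C M) (C W) X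
  let P : ℝ[X][X] := resultant f g 4 4
  have hP : ∀ s, P.evalEval s 0 = 0 := by
    apply coeff_zero_of_freq P t0
    refine h.mono ?_
    rintro s ⟨a', b', c', d', ρ, ha, hb, hc', hd, hf, hg⟩
    obtain ⟨p, q, -, -, hpq⟩ := exists_mul_add_mul_eq_C_resultant (m := 4) (n := 4) f g (deg_fR _ _ _ _ _)
      (deg_gR _ _ _ _ _ _ _ _) (by norm_num)
    let φ : ℝ[X][X] →+* ℝ := evalEvalRingHom s (Real.exp (-2 * s))
    have h1 := congrArg (eval₂RingHom φ ρ) hpq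
    have hk : ∀ z, φ (k z) = z := fun z => by simp [φ, k]
    have he : φ e = Real.exp (-s) ^ 2 := by
      simp [φ, e, ← Real.exp_nat_mul]
    have ht : φ t = s := by simp [φ, t]
    have hE : Real.exp s * Real.exp (-s) = 1 := by rw [← Real.exp_add]; simp
    set u := Real.exp (-s) with hu
    have hcc : φ c = u * c' := by
      simp only [c, map_add, map_mul, hk, he, hc']
      linear_combination (-c1) * hE
    have hdd : φ d = u * d' := by
      simp only [d, map_sub, map_mul, hk, he, hd]
      linear_combination (-c1) * hE
    have haa : φ a = a' := by simp only [a, map_add, map_mul, hk, ht, ha]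
    have hbb : φ b = b' := by simp only [b, map_add, map_mul, hk, ht, hb]
    have hf1 : eval₂RingHom φ ρ f = 0 := by
      refine (map_fR (eval₂RingHom φ ρ) (C c) (C d) (C N) (C μ) (C Λ) X).trans ?_
      simp only [coe_eval₂RingHom, eval₂_C, eval₂_X, N, μ, Λ, map_add, map_mul, map_pow, hk, he,
        hcc, hdd, haa, hbb, map_ofNat]
      rw [fR] at hf ⊢
      linear_combination u ^ 5 * hf
    have hg1 : eval₂RingHom φ ρ g = 0 := by
      refine (map_gR (eval₂RingHom φ ρ) (C c) (C d) (C N) (C μ) (C L) (C m) (C M) (C W) X).trans ?_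
      simp only [coe_eval₂RingHom, eval₂_C, eval₂_X, N, μ, L, m, M, W, map_add, map_sub,
        map_mul, map_pow, hk, he, hcc, hdd, haa, hbb]
      rw [gR] at hg ⊢
      linear_combination u ^ 6 * hg
    rw [map_add, map_mul, map_mul, hf1, hg1] at h1
    simp only [coe_eval₂RingHom, eval₂_C] at h1
    have h2 : φ P = 0 := by rw [← h1]; ring
    exact h2
  -- specialise
  let s : ℝ := -(A * A0 + B * B0) / (A ^ 2 + B ^ 2)
  let φ : ℝ[X][X] →+* ℝ := evalEvalRingHom s 0
  have hk : ∀ z, φ (k z) = z := fun z => by simp [φ, k]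
  have he : φ e = 0 := by simp [φ, e]
  have ht : φ t = s := by simp [φ, t]
  have h1 : resultant (f.map φ) (g.map φ) 4 4 = 0 := by
    rw [resultant_map_map]; exact hP s
  have hcc : φ c = c1 := by simp only [c, map_add, map_mul, hk, he]; ring
  have hdd : φ d = c1 := by simp only [d, map_sub, map_mul, hk, he]; ring
  have hNN : φ N = c1 ^ 2 := by simp only [N, map_add, map_mul, map_pow, he, hcc]; ring
  have hμμ : φ μ = c1 ^ 2 := by simp only [μ, map_add, map_mul, he, hcc, hdd]; ring
  have hΛΛ : φ Λ = 10 * c1 ^ 2 := by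
    simp only [Λ, map_add, map_mul, map_pow, map_ofNat, he, hcc, hdd, hNN]; ring
  have haa : φ a = A * s + A0 := by simp only [a, map_add, map_mul, hk, ht]
  have hbb : φ b = B * s + B0 := by simp only [b, map_add, map_mul, hk, ht]
  have hLL : φ L = A ^ 2 + B ^ 2 := by simp only [L, map_add, map_pow, hk]
  have hmm : φ m = (A * s + A0) * A + (B * s + B0) * B := by
    simp only [m, map_add, map_mul, hk, haa, hbb]
  have hMM : φ M = (A * s + A0) ^ 2 + (B * s + B0) ^ 2 := by
    simp only [M, map_add, map_pow, haa, hbb]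
  have hWW : φ W = 0 := by simp only [W, map_mul, he, zero_mul]
  have hfm0 : f.map φ = fR (C c1) (C c1) (C (c1 ^ 2)) (C (c1 ^ 2)) (C (10 * c1 ^ 2)) X := by
    have := map_fR (mapRingHom φ) (C c) (C d) (C N) (C μ) (C Λ) X
    simpa only [coe_mapRingHom, map_C, map_X, hcc, hdd, hNN, hμμ, hΛΛ] using this
  have hfm : f.map φ = C (-4 * c1 ^ 5 * 2) * ((X - C (-1)) * (X - C (-1)) *
      (X - C ((-7 + √17) / 4)) * (X - C ((-7 - √17) / 4))) := by
    rw [hfm0, fR]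
    have h17 : (C (√17) : ℝ[X]) ^ 2 = 17 := by
      rw [← C_pow, Real.sq_sqrt (by norm_num)]; rfl
    have hq : (X - C ((-7 + √17) / 4)) * (X - C ((-7 - √17) / 4)) = X ^ 2 + C (7 / 2) * X + C (2 : ℝ) := by
      have e1 : C (7 / 2 : ℝ) = - (C ((-7 + √17) / 4) + C ((-7 - √17) / 4)) := by
        rw [← C_add, ← C_neg]; congr 1; ring
      have e2 : C (2 : ℝ) = C ((-7 + √17) / 4) * C ((-7 - √17) / 4) := by
        rw [← C_mul]; congr 1
        have : √17 ^ 2 = (17 : ℝ) := Real.sq_sqrt (by norm_num)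
        linear_combination (1 / 16) * this
      rw [e1, e2]; ring
    have h72 : 2 * C (7 / 2 : ℝ) = 7 := by
      rw [show (2 : ℝ[X]) = C 2 from rfl, ← C_mul, show (7 : ℝ[X]) = C 7 from rfl]; norm_num
    have h2 : C (2 : ℝ) = 2 := rfl
    have h4 : C (-4 : ℝ) = -4 := by rw [C_neg]; rfl
    have h1 : C (-1 : ℝ) = -1 := by rw [C_neg]; rfl
    have h10 : C (10 : ℝ) = 10 := rfl
    rw [mul_assoc ((X - C (-1)) * (X - C (-1))), hq]
    simp only [C_mul, C_pow, h2, h4, h1, h10]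
    linear_combination 4 * (C c1) ^ 5 * X * (X + 1) ^ 2 * h72
  have hdeg : (f.map φ).natDegree = 4 := by
    have hk0 : -4 * c1 ^ 5 * 2 ≠ 0 := by positivity
    rw [hfm, natDegree_C_mul hk0]
    compute_degree!
  have hsp : (f.map φ).Splits := by
    rw [hfm]
    exact (Splits.C _).mul ((((Splits.X_sub_C _).mul (Splits.X_sub_C _)).mul
      (Splits.X_sub_C _)).mul (Splits.X_sub_C _))
  have hgd : (g.map φ).natDegree ≤ 4 := natDegree_map_le.trans (deg_gR _ _ _ _ _ _ _ _)
  have h2 := resultant_eq_prod_eval (f.map φ) (g.map φ) 4 hgd hsp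
  rw [hdeg, h1] at h2
  have hf0 : f.map φ ≠ 0 := by
    intro h; rw [h] at hdeg; simp at hdeg
  have h3 : ((f.map φ).roots.map (g.map φ).eval).prod = 0 := by
    rcases mul_eq_zero.mp h2.symm with h | h
    · exact absurd (pow_eq_zero_iff (by norm_num) |>.mp h) (leadingCoeff_ne_zero.mpr hf0)
    · exact h
  rw [Multiset.prod_eq_zero_iff, Multiset.mem_map] at h3
  obtain ⟨ρ, hρ, hgρ⟩ := h3
  rw [mem_roots hf0, IsRoot.def] at hρ
  rw [eval_map] at hρ hgρ
  have e1 := map_fR (eval₂RingHom φ ρ) (C c) (C d) (C N) (C μ) (C Λ) X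
  have e2 := map_gR (eval₂RingHom φ ρ) (C c) (C d) (C N) (C μ) (C L) (C m) (C M) (C W) X
  simp only [coe_eval₂RingHom, eval₂_C, eval₂_X, hcc, hdd, hNN, hμμ, hΛΛ, hLL, hmm, hMM, hWW] at e1 e2
  replace hρ := e1.symm.trans hρ
  replace hgρ := e2.symm.trans hgρ
  have hm : (A * s + A0) * A + (B * s + B0) * B = 0 := by
    simp only [s]; field_simp; ring
  clear_value s
  rw [fR] at hρ
  rw [gR] at hgρ
  have hρ' : c1 ^ 5 * ((1 + ρ) ^ 2 * (2 * ρ ^ 2 + 7 * ρ + 4)) = 0 := by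
    linear_combination (-1 / 4) * hρ
  have hg' : c1 ^ 6 * ((A ^ 2 + B ^ 2) * (ρ * (3 + 2 * ρ)) ^ 2
      + ((A * s + A0) ^ 2 + (B * s + B0) ^ 2) * (2 * ρ ^ 2 + 3 * ρ + 1) ^ 2) = 0 := by
    linear_combination hgρ + 2 * c1 ^ 6 * (2 * ρ ^ 2 + 3 * ρ + 1) * ρ * (3 + 2 * ρ) * hm
  have hLp : 0 < A ^ 2 + B ^ 2 := lt_of_le_of_ne (by positivity) hL.symm
  have hu : ρ * (3 + 2 * ρ) = 0 := by
    have h5 := (mul_eq_zero.mp hg').resolve_left (pow_ne_zero _ hc)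
    by_contra hne
    have : 0 < (ρ * (3 + 2 * ρ)) ^ 2 := by positivity
    have h6 := mul_pos hLp this
    have h7 : 0 ≤ ((A * s + A0) ^ 2 + (B * s + B0) ^ 2) * (2 * ρ ^ 2 + 3 * ρ + 1) ^ 2 := by
      positivity
    linarith
  have h8 := (mul_eq_zero.mp hρ').resolve_left (pow_ne_zero _ hc)
  rcases mul_eq_zero.mp hu with h | h
  · subst h; norm_num at h8
  · have : ρ = -3 / 2 := by linarith
    subst this; norm_num at h8


lemma dzero {U : Set ℝ} (hU : IsOpen U) {F : ℝ → ℝ} {k F' s : ℝ} (h : ∀ s ∈ U, F s = k)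
    (hs : s ∈ U) (hF : HasDerivAt F F' s) : F' = 0 := by
  have h1 : F =ᶠ[𝓝 s] fun _ => k := by
    filter_upwards [hU.mem_nhds hs] with u hu using h u hu
  exact hF.unique ((hasDerivAt_const s k).congr_of_eventuallyEq h1)

lemma const_on {lo hi : ℝ} {F : ℝ → ℝ} (h : ∀ s ∈ Ioo lo hi, HasDerivAt F 0 s)
    {s t : ℝ} (hs : s ∈ Ioo lo hi) (ht : t ∈ Ioo lo hi) : F s = F t :=
  isOpen_Ioo.is_const_of_deriv_eq_zero isPreconnected_Ioo
    (fun u hu => (h u hu).differentiableAt.differentiableWithinAt)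
    (fun u hu => (h u hu).deriv) hs ht

lemma core {lo hi : ℝ} (r ρ X Y a b c d τ : ℝ → ℝ) (A B : ℝ)
    (hrp : ∀ s ∈ Ioo lo hi, 0 < r s)
    (harc : ∀ s ∈ Ioo lo hi, X s ^ 2 + Y s ^ 2 + ρ s ^ 2 = 1)
    (hr : ∀ s ∈ Ioo lo hi, HasDerivAt r (ρ s) s)
    (hρ : ∀ s ∈ Ioo lo hi, HasDerivAt ρ (c s - (ρ s ^ 2 - 1) / r s) s)
    (hX : ∀ s ∈ Ioo lo hi, HasDerivAt X (a s - ρ s / r s * X s) s)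
    (hY : ∀ s ∈ Ioo lo hi, HasDerivAt Y (b s - ρ s / r s * Y s) s)
    (ha : ∀ s ∈ Ioo lo hi, HasDerivAt a (A / r s) s)
    (hb : ∀ s ∈ Ioo lo hi, HasDerivAt b (B / r s) s)
    (hc : ∀ s ∈ Ioo lo hi, HasDerivAt c (d s / r s) s)
    (hd : ∀ s ∈ Ioo lo hi, HasDerivAt d (c s / r s) s)
    (hτ : ∀ s ∈ Ioo lo hi, HasDerivAt τ (1 / r s) s) :
    ∀ s ∈ Ioo lo hi, a s = 0 ∧ b s = 0 ∧ c s = 0 := by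
  have hU : IsOpen (Ioo lo hi) := isOpen_Ioo
  have E0 : ∀ s ∈ Ioo lo hi, a s * X s + b s * Y s + c s * ρ s = 0 := by
    intro s hs
    have hr0 := (hrp s hs).ne'
    have h := dzero hU harc hs ((((hX s hs).pow 2).add ((hY s hs).pow 2)).add ((hρ s hs).pow 2))
    have h2 := harc s hs
    field_simp at h
    have : r s * (a s * X s + b s * Y s + c s * ρ s) = 0 := by
      linear_combination h / 2 + ρ s * h2
    exact (mul_eq_zero.mp this).resolve_left hr0
  have E1 : ∀ s ∈ Ioo lo hi, (a s ^ 2 + b s ^ 2 + c s ^ 2) * r s + c s + A * X s + B * Y s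
      + d s * ρ s = 0 := by
    intro s hs
    have hr0 := (hrp s hs).ne'
    have h := dzero hU E0 hs ((((ha s hs).mul (hX s hs)).add ((hb s hs).mul (hY s hs))).add
      ((hc s hs).mul (hρ s hs)))
    have h2 := E0 s hs
    field_simp at h
    linear_combination h + ρ s * h2
  have E2 : ∀ s ∈ Ioo lo hi, 3 * (a s * A + b s * B + c s * d s) * r s
      + 2 * ρ s * ((a s ^ 2 + b s ^ 2 + c s ^ 2) * r s) + 2 * (d s + c s * ρ s) = 0 := by
    intro s hs
    have hr0 := (hrp s hs).ne'
    have h := dzero hU E1 hs (((((((((ha s hs).pow 2).add ((hb s hs).pow 2)).add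
      ((hc s hs).pow 2)).mul (hr s hs)).add (hc s hs)).add ((hX s hs).const_mul A)).add
      ((hY s hs).const_mul B)).add ((hd s hs).mul (hρ s hs)))
    have h2 := E1 s hs
    simp only [Pi.add_apply, Pi.pow_apply] at h
    field_simp at h
    linear_combination h + ρ s * h2
  have E3 : ∀ s ∈ Ioo lo hi, 2 * (a s ^ 2 + b s ^ 2 + c s ^ 2) * ρ s ^ 2 * r s
      + 10 * (a s * A + b s * B + c s * d s) * ρ s * r s + 4 * d s * ρ s
      + 2 * c s * (a s ^ 2 + b s ^ 2 + c s ^ 2) * r s ^ 2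
      + (3 * (A ^ 2 + B ^ 2 + d s ^ 2 + c s ^ 2) + 2 * (a s ^ 2 + b s ^ 2 + c s ^ 2)
        + 2 * c s ^ 2) * r s + 4 * c s = 0 := by
    intro s hs
    have hr0 := (hrp s hs).ne'
    have h := dzero hU E2 hs (((((((((ha s hs).mul_const A).add ((hb s hs).mul_const B)).add
      ((hc s hs).mul (hd s hs))).const_mul 3).mul (hr s hs))).add
      (((hρ s hs).const_mul 2).mul (((((ha s hs).pow 2).add ((hb s hs).pow 2)).add
      ((hc s hs).pow 2)).mul (hr s hs)))).add
      (((hd s hs).add ((hc s hs).mul (hρ s hs))).const_mul 2))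
    have h2 := E2 s hs
    simp only [Pi.add_apply, Pi.pow_apply, Pi.mul_apply] at h
    field_simp at h
    linear_combination h + ρ s * h2
  have hf : ∀ s ∈ Ioo lo hi, fR (c s) (d s) (a s ^ 2 + b s ^ 2 + c s ^ 2)
      (a s * A + b s * B + c s * d s) (3 * (A ^ 2 + B ^ 2 + d s ^ 2 + c s ^ 2)
        + 2 * (a s ^ 2 + b s ^ 2 + c s ^ 2) + 2 * c s ^ 2) (ρ s) = 0 := by
    intro s hs
    have h2 := E2 s hs
    have h3 := E3 s hs
    unfold fR
    generalize a s ^ 2 + b s ^ 2 + c s ^ 2 = N at *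
    generalize a s * A + b s * B + c s * d s = μ at *
    generalize 3 * (A ^ 2 + B ^ 2 + d s ^ 2 + c s ^ 2) + 2 * N + 2 * c s ^ 2 = Λ at *
    linear_combination (3 * μ + 2 * N * ρ s) ^ 2 * h3
      - ((2 * N * ρ s ^ 2 + 10 * μ * ρ s + Λ) * (3 * μ + 2 * N * ρ s)
        + 2 * c s * N * (r s * (3 * μ + 2 * N * ρ s) - 2 * (d s + c s * ρ s))) * h2
  have hg : ∀ s ∈ Ioo lo hi, gR (c s) (d s) (a s ^ 2 + b s ^ 2 + c s ^ 2)
      (a s * A + b s * B + c s * d s) (A ^ 2 + B ^ 2) (a s * A + b s * B)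
        (a s ^ 2 + b s ^ 2) ((a s * B - b s * A) ^ 2) (ρ s) = 0 := by
    intro s hs
    have h0 := E0 s hs
    have h1 := E1 s hs
    have h2 := E2 s hs
    have h4 : 1 - ρ s ^ 2 = X s ^ 2 + Y s ^ 2 := by linarith [harc s hs]
    unfold gR
    generalize a s ^ 2 + b s ^ 2 + c s ^ 2 = N at *
    generalize a s * A + b s * B + c s * d s = μ at *
    have hp : c s * ρ s = -(a s * X s + b s * Y s) := by linarith
    have hq : 2 * N * d s * ρ s ^ 2 + 3 * μ * d s * ρ s + 3 * μ * c s - 2 * N * d s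
        = (3 * μ + 2 * N * ρ s) * -(A * X s + B * Y s) := by
      linear_combination (-N) * h2 + (3 * μ + 2 * N * ρ s) * h1
    rw [hq, h4, show (A ^ 2 + B ^ 2) * c s ^ 2 * ρ s ^ 2 = (A ^ 2 + B ^ 2) * (c s * ρ s) ^ 2 by ring,
      mul_assoc (2 * (a s * A + b s * B)) (c s) (ρ s), hp]
    ring
  intro s0 hs0
  have hr0 := hrp s0 hs0
  -- explicit formulas
  set A0 := a s0 - A * τ s0 with hA0
  set B0 := b s0 - B * τ s0 with hB0
  have fa : ∀ s ∈ Ioo lo hi, a s = A * τ s + A0 := by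
    intro s hs
    have := const_on (F := fun s => a s - A * τ s) (fun u hu => by
      convert! (ha u hu).sub ((hτ u hu).const_mul A) using 1; ring) hs hs0
    linarith
  have fb : ∀ s ∈ Ioo lo hi, b s = B * τ s + B0 := by
    intro s hs
    have := const_on (F := fun s => b s - B * τ s) (fun u hu => by
      convert! (hb u hu).sub ((hτ u hu).const_mul B) using 1; ring) hs hs0
    linarith
  obtain ⟨c1, hc1⟩ : ∃ k, ∀ s ∈ Ioo lo hi, (c s + d s) * Real.exp (-τ s) = 2 * k :=
    ⟨(c s0 + d s0) * Real.exp (-τ s0) / 2, fun s hs => by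
      have := const_on (F := fun s => (c s + d s) * Real.exp (-τ s)) (fun u hu => by
        convert! ((hc u hu).add (hd u hu)).mul ((hτ u hu).neg.exp) using 1
        simp only [Pi.add_apply, Pi.neg_apply]; ring) hs hs0
      linarith⟩
  obtain ⟨d1, hd1⟩ : ∃ k, ∀ s ∈ Ioo lo hi, (c s - d s) * Real.exp (τ s) = 2 * k :=
    ⟨(c s0 - d s0) * Real.exp (τ s0) / 2, fun s hs => by
      have := const_on (F := fun s => (c s - d s) * Real.exp (τ s)) (fun u hu => by
        convert! ((hc u hu).sub (hd u hu)).mul ((hτ u hu).exp) using 1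
        simp only [Pi.sub_apply]; ring) hs hs0
      linarith⟩
  have fc : ∀ s ∈ Ioo lo hi, c s = c1 * Real.exp (τ s) + d1 * Real.exp (-τ s) := by
    intro s hs
    have hE : Real.exp (τ s) * Real.exp (-τ s) = 1 := by rw [← Real.exp_add]; simp
    linear_combination Real.exp (τ s) / 2 * hc1 s hs + Real.exp (-τ s) / 2 * hd1 s hs
      - c s * hE
  have fd : ∀ s ∈ Ioo lo hi, d s = c1 * Real.exp (τ s) - d1 * Real.exp (-τ s) := by
    intro s hs
    have hE : Real.exp (τ s) * Real.exp (-τ s) = 1 := by rw [← Real.exp_add]; simp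
    linear_combination Real.exp (τ s) / 2 * hc1 s hs - Real.exp (-τ s) / 2 * hd1 s hs
      - d s * hE
  have hev : ∀ᶠ s in 𝓝[≠] s0, s ∈ Ioo lo hi :=
    mem_nhdsWithin_of_mem_nhds (hU.mem_nhds hs0)
  -- the case c = 0
  have hczero : (∀ s ∈ Ioo lo hi, c s = 0) → a s0 = 0 ∧ b s0 = 0 ∧ c s0 = 0 := by
    intro hz
    have hdz : ∀ s ∈ Ioo lo hi, d s = 0 := by
      intro s hs
      have := dzero hU hz hs (hc s hs)
      exact (div_eq_zero_iff.mp this).resolve_right (hrp s hs).ne'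
    have H0 : ∀ s ∈ Ioo lo hi, 4 * (a s ^ 2 + b s ^ 2) ^ 2
        + 6 * (A ^ 2 + B ^ 2) * (a s ^ 2 + b s ^ 2) - 21 * (a s * A + b s * B) ^ 2 = 0 := by
      intro s hs
      have h2 := E2 s hs
      have h3 := E3 s hs
      rw [hz s hs, hdz s hs] at h2 h3
      have hr0 := (hrp s hs).ne'
      have h2' : 3 * (a s * A + b s * B) + 2 * ρ s * (a s ^ 2 + b s ^ 2) = 0 := by
        have : r s * (3 * (a s * A + b s * B) + 2 * ρ s * (a s ^ 2 + b s ^ 2)) = 0 := by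
          linear_combination h2
        exact (mul_eq_zero.mp this).resolve_left hr0
      have h3' : 2 * (a s ^ 2 + b s ^ 2) * ρ s ^ 2 + 10 * (a s * A + b s * B) * ρ s
          + 3 * (A ^ 2 + B ^ 2) + 2 * (a s ^ 2 + b s ^ 2) = 0 := by
        have : r s * (2 * (a s ^ 2 + b s ^ 2) * ρ s ^ 2 + 10 * (a s * A + b s * B) * ρ s
          + 3 * (A ^ 2 + B ^ 2) + 2 * (a s ^ 2 + b s ^ 2)) = 0 := by
          linear_combination h3
        exact (mul_eq_zero.mp this).resolve_left hr0
      linear_combination 2 * (a s ^ 2 + b s ^ 2) * h3'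
        - (2 * ρ s * (a s ^ 2 + b s ^ 2) + 7 * (a s * A + b s * B)) * h2'
    have H1 : ∀ s ∈ Ioo lo hi, (a s * A + b s * B) *
        (16 * (a s ^ 2 + b s ^ 2) - 30 * (A ^ 2 + B ^ 2)) = 0 := by
      intro s hs
      have hr0 := (hrp s hs).ne'
      have hM := ((ha s hs).pow 2).add ((hb s hs).pow 2)
      have hm := ((ha s hs).mul_const A).add ((hb s hs).mul_const B)
      have h := dzero hU H0 hs ((((hM.pow 2).const_mul 4).add
        (hM.const_mul (6 * (A ^ 2 + B ^ 2)))).sub ((hm.pow 2).const_mul 21))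
      simp only [Pi.add_apply, Pi.pow_apply, Pi.mul_apply] at h
      field_simp at h
      linear_combination h
    have H2 : ∀ s ∈ Ioo lo hi, (A ^ 2 + B ^ 2) *
        (16 * (a s ^ 2 + b s ^ 2) - 30 * (A ^ 2 + B ^ 2)) + 32 * (a s * A + b s * B) ^ 2 = 0 := by
      intro s hs
      have hr0 := (hrp s hs).ne'
      have hM := ((ha s hs).pow 2).add ((hb s hs).pow 2)
      have hm := ((ha s hs).mul_const A).add ((hb s hs).mul_const B)
      have h := dzero hU H1 hs (hm.mul ((hM.const_mul 16).sub_const (30 * (A ^ 2 + B ^ 2))))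
      simp only [Pi.add_apply, Pi.pow_apply, Pi.mul_apply] at h
      field_simp at h
      linear_combination h
    have h0 := H0 s0 hs0
    have h1 := H1 s0 hs0
    have h2 := H2 s0 hs0
    have hm : a s0 * A + b s0 * B = 0 := by
      rcases mul_eq_zero.mp h1 with h | h
      · exact h
      · rw [h] at h2
        have : (a s0 * A + b s0 * B) ^ 2 = 0 := by linarith
        exact pow_eq_zero_iff (by norm_num) |>.mp this
    rw [hm] at h0
    have hM : a s0 ^ 2 + b s0 ^ 2 = 0 := by
      have hLM : 0 ≤ (A ^ 2 + B ^ 2) * (a s0 ^ 2 + b s0 ^ 2) := by positivity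
      have : (a s0 ^ 2 + b s0 ^ 2) ^ 2 = 0 := by
        apply le_antisymm _ (by positivity)
        linarith
      exact pow_eq_zero_iff (by norm_num) |>.mp this
    refine ⟨?_, ?_, hz s0 hs0⟩
    · nlinarith [sq_nonneg (a s0), sq_nonneg (b s0)]
    · nlinarith [sq_nonneg (a s0), sq_nonneg (b s0)]
  by_cases hL : A ^ 2 + B ^ 2 = 0
  · have hA : A = 0 := by nlinarith [sq_nonneg A, sq_nonneg B]
    have hB : B = 0 := by nlinarith [sq_nonneg A, sq_nonneg B]
    by_contra hcon
    have hz : ¬ ∀ s ∈ Ioo lo hi, c s = 0 := fun h => hcon (hczero h)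
    push Not at hz
    obtain ⟨s1, hs1, hcs1⟩ := hz
    have hcc : ContinuousOn c (Ioo lo hi) := fun s hs => (hc s hs).continuousAt.continuousWithinAt
    have hdc : ContinuousOn d (Ioo lo hi) := fun s hs => (hd s hs).continuousAt.continuousWithinAt
    have hV : IsOpen (Ioo lo hi ∩ c ⁻¹' {0}ᶜ) := hcc.isOpen_inter_preimage hU isOpen_compl_singleton
    obtain ⟨s2, hs2, hds2⟩ : ∃ s ∈ Ioo lo hi ∩ c ⁻¹' {0}ᶜ, d s ≠ 0 := by
      by_contra! hcon2
      have := dzero hV hcon2 ⟨hs1, hcs1⟩ (hd s1 hs1)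
      rcases div_eq_zero_iff.mp this with h | h
      · exact hcs1 h
      · exact (hrp s1 hs1).ne' h
    have hW : IsOpen ((Ioo lo hi ∩ c ⁻¹' {0}ᶜ) ∩ d ⁻¹' {0}ᶜ) :=
      (hdc.mono inter_subset_left).isOpen_inter_preimage hV isOpen_compl_singleton
    set V := (Ioo lo hi ∩ c ⁻¹' {0}ᶜ) ∩ d ⁻¹' {0}ᶜ with hVdef
    have F1 : ∀ s ∈ V, 3 * (c s * r s) + 2 * (1 - ρ s ^ 2) = 0 := by
      rintro s ⟨⟨hs, -⟩, hds⟩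
      have h1 := E1 s hs
      have h2 := E2 s hs
      rw [hA, hB] at h1 h2
      have : d s * (3 * (c s * r s) + 2 * (1 - ρ s ^ 2)) = 0 := by
        linear_combination h2 - 2 * ρ s * h1
      exact (mul_eq_zero.mp this).resolve_left hds
    have F2 : ∀ s ∈ V, 9 * (d s * r s) - 10 * (ρ s * (1 - ρ s ^ 2)) = 0 := by
      intro s hsV
      have hs := hsV.1.1
      have hr0 := (hrp s hs).ne'
      have h := dzero hW F1 hsV ((((hc s hs).mul (hr s hs)).const_mul 3).add
        ((((hρ s hs).pow 2).const_sub 1).const_mul 2))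
      have h1 := F1 s hsV
      field_simp at h
      linear_combination 3 * h + ρ s * h1
    have F3 : (1 - ρ s2 ^ 2) * (15 * ρ s2 ^ 2 - 7) = 0 := by
      have hsV : s2 ∈ V := ⟨hs2, hds2⟩
      have hs := hsV.1.1
      have hr0 := (hrp s2 hs).ne'
      have h := dzero hW F2 hsV ((((hd s2 hs).mul (hr s2 hs)).const_mul 9).sub
        (((hρ s2 hs).mul (((hρ s2 hs).pow 2).const_sub 1)).const_mul 10))
      have h1 := F1 s2 hsV
      have h2 := F2 s2 hsV
      simp only [Pi.pow_apply] at h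
      field_simp at h
      linear_combination 3 / 4 * h - 3 / 4 * (3 - 10 / 3 * (1 - 3 * ρ s2 ^ 2)) * h1
        - 3 / 4 * ρ s2 * h2
    have hsV : s2 ∈ V := ⟨hs2, hds2⟩
    have h1 := F1 s2 hsV
    have h2 := F2 s2 hsV
    have hrp2 := hrp s2 hs2.1
    have hz0 : 1 - ρ s2 ^ 2 ≠ 0 := by
      intro h
      rw [h] at h1
      have : c s2 * r s2 = 0 := by linarith
      rcases mul_eq_zero.mp this with h | h
      · exact hs2.2 h
      · exact hrp2.ne' h
    have h3 : ρ s2 ^ 2 = 7 / 15 := by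
      have := (mul_eq_zero.mp F3).resolve_left hz0
      linarith
    have h4 := E1 s2 hs2.1
    rw [hA, hB] at h4
    have h5 : (a s2 ^ 2 + b s2 ^ 2) * r s2 ^ 2 + (c s2 * r s2) ^ 2 + c s2 * r s2
        + ρ s2 * (d s2 * r s2) = 0 := by linear_combination r s2 * h4
    have h6 : c s2 * r s2 = -16 / 45 := by linarith
    have h7 : ρ s2 * (d s2 * r s2) = 112 / 405 := by
      rw [h3] at h2
      have : d s2 * r s2 = 16 / 27 * ρ s2 := by linarith
      rw [this]; linear_combination 16 / 27 * h3
    rw [h6, h7] at h5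
    have : 0 ≤ (a s2 ^ 2 + b s2 ^ 2) * r s2 ^ 2 := by positivity
    norm_num at h5
    linarith
  · by_cases hc10 : c1 = 0
    · by_cases hd10 : d1 = 0
      · apply hczero
        intro s hs
        rw [fc s hs, hc10, hd10]; ring
      · exfalso
        have htd : Tendsto (fun s => -τ s) (𝓝[≠] s0) (𝓝[≠] (-τ s0)) :=
          (hτ s0 hs0).neg.tendsto_nhdsNE (by simp [hr0.ne'])
        refine key (-A) A0 (-B) B0 d1 c1 hd10 (by simpa using hL) (-τ s0) (htd.frequently ?_)
        refine Eventually.frequently ?_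
        filter_upwards [hev] with s hs
        refine ⟨a s, b s, c s, -d s, -ρ s, ?_, ?_, ?_, ?_, ?_, ?_⟩
        · rw [fa s hs]; ring
        · rw [fb s hs]; ring
        · rw [fc s hs, neg_neg]; ring
        · rw [fd s hs, neg_neg]; ring
        · have := hf s hs
          unfold fR at this ⊢
          linear_combination this
        · have := hg s hs
          unfold gR at this ⊢
          linear_combination this
    · exfalso
      have htd : Tendsto τ (𝓝[≠] s0) (𝓝[≠] (τ s0)) :=
        (hτ s0 hs0).tendsto_nhdsNE (by simp [hr0.ne'])
      refine key A A0 B B0 c1 d1 hc10 hL (τ s0) (htd.frequently ?_)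
      refine Eventually.frequently ?_
      filter_upwards [hev] with s hs
      exact ⟨a s, b s, c s, d s, ρ s, fa s hs, fb s hs, fc s hs, fd s hs, hf s hs, hg s hs⟩

end Biharm

namespace Biharm

lemma smooth_deriv {lo hi : ℝ} {f : ℝ → ℝ} (hf : ContDiffOn ℝ (⊤ : ℕ∞) f (Ioo lo hi)) :
    ContDiffOn ℝ (⊤ : ℕ∞) (deriv f) (Ioo lo hi) :=
  ((contDiffOn_infty_iff_deriv_of_isOpen isOpen_Ioo).mp hf).2

lemma smooth_has {lo hi : ℝ} {f : ℝ → ℝ} (hf : ContDiffOn ℝ (⊤ : ℕ∞) f (Ioo lo hi)) {s : ℝ}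
    (hs : s ∈ Ioo lo hi) : HasDerivAt f (deriv f s) s :=
  ((((contDiffOn_infty_iff_deriv_of_isOpen isOpen_Ioo).mp hf).1 s hs).differentiableAt
    (isOpen_Ioo.mem_nhds hs)).hasDerivAt

end Biharm

/-- Any biharmonic simple rotational surface in `𝔼⁴` is minimal: if the profile
curve `(x, y, r)` is arc-length parametrized, `r > 0`, and the functions
`a = x'' + (r'/r)x'`, `b = y'' + (r'/r)y'`, `c = r'' + (r'² - 1)/r` satisfy the
biharmonic ODE system, then `a`, `b`, `c` vanish identically. -/
theorem biharmonic_simple_rotational_surface_minimal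
    (lo hi : ℝ) (hlt : lo < hi) (x y r : ℝ → ℝ)
    (hx : ContDiffOn ℝ (⊤ : ℕ∞) x (Ioo lo hi))
    (hy : ContDiffOn ℝ (⊤ : ℕ∞) y (Ioo lo hi))
    (hr : ContDiffOn ℝ (⊤ : ℕ∞) r (Ioo lo hi))
    (hrpos : ∀ s ∈ Ioo lo hi, 0 < r s)
    (harc : ∀ s ∈ Ioo lo hi,
      deriv x s ^ 2 + deriv y s ^ 2 + deriv r s ^ 2 = 1)
    (a b c : ℝ → ℝ)
    (ha : ∀ s ∈ Ioo lo hi,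
      a s = deriv (deriv x) s + (deriv r s / r s) * deriv x s)
    (hb : ∀ s ∈ Ioo lo hi,
      b s = deriv (deriv y) s + (deriv r s / r s) * deriv y s)
    (hc : ∀ s ∈ Ioo lo hi,
      c s = deriv (deriv r) s + (deriv r s ^ 2 - 1) / r s)
    (hODEa : ∀ s ∈ Ioo lo hi,
      deriv (deriv a) s + (deriv r s / r s) * deriv a s = 0)
    (hODEb : ∀ s ∈ Ioo lo hi,
      deriv (deriv b) s + (deriv r s / r s) * deriv b s = 0)
    (hODEc : ∀ s ∈ Ioo lo hi,
      deriv (deriv c) s + (deriv r s / r s) * deriv c s - c s / r s ^ 2 = 0) :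
    ∀ s ∈ Ioo lo hi, a s = 0 ∧ b s = 0 ∧ c s = 0 := by
  have hU : IsOpen (Ioo lo hi) := isOpen_Ioo
  have hn : ∀ s ∈ Ioo lo hi, r s ≠ 0 := fun s hs => (hrpos s hs).ne'
  have dx := Biharm.smooth_deriv hx
  have dy := Biharm.smooth_deriv hy
  have dr := Biharm.smooth_deriv hr
  have ddx := Biharm.smooth_deriv dx
  have ddy := Biharm.smooth_deriv dy
  have ddr := Biharm.smooth_deriv dr
  have sa : ContDiffOn ℝ (⊤ : ℕ∞) a (Ioo lo hi) :=
    (ddx.add ((dr.div hr hn).mul dx)).congr ha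
  have sb : ContDiffOn ℝ (⊤ : ℕ∞) b (Ioo lo hi) :=
    (ddy.add ((dr.div hr hn).mul dy)).congr hb
  have sc : ContDiffOn ℝ (⊤ : ℕ∞) c (Ioo lo hi) :=
    (ddr.add (((dr.pow 2).sub contDiffOn_const).div hr hn)).congr hc
  have da := Biharm.smooth_deriv sa
  have db := Biharm.smooth_deriv sb
  have dc := Biharm.smooth_deriv sc
  have hm : (lo + hi) / 2 ∈ Ioo lo hi := ⟨by linarith, by linarith⟩
  have cst : ∀ f : ℝ → ℝ, ContDiffOn ℝ (⊤ : ℕ∞) f (Ioo lo hi) →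
      (∀ s ∈ Ioo lo hi, deriv (deriv f) s + (deriv r s / r s) * deriv f s = 0) →
      ∀ s ∈ Ioo lo hi,
        HasDerivAt f (r ((lo + hi) / 2) * deriv f ((lo + hi) / 2) / r s) s := by
    intro f hf hode s hs
    have h := Biharm.const_on (F := fun u => r u * deriv f u) (fun u hu => by
      convert! (Biharm.smooth_has hr hu).mul (Biharm.smooth_has (Biharm.smooth_deriv hf) hu) using 1
      have h1 := hode u hu
      have h2 := hn u hu
      field_simp at h1
      linear_combination -h1) hs hm
    convert! Biharm.smooth_has hf hs using 1
    rw [← h]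
    field_simp [hn s hs]
  refine Biharm.core r (deriv r) (deriv x) (deriv y) a b c (fun s => r s * deriv c s)
    (fun s => ∫ u in ((lo + hi) / 2)..s, 1 / r u) _ _ hrpos harc
    (fun s hs => Biharm.smooth_has hr hs) ?_ ?_ ?_ (cst a sa hODEa) (cst b sb hODEb) ?_ ?_ ?_
  · intro s hs
    convert! Biharm.smooth_has dr hs using 1
    rw [hc s hs]; ring
  · intro s hs
    convert! Biharm.smooth_has dx hs using 1
    rw [ha s hs]; ring
  · intro s hs
    convert! Biharm.smooth_has dy hs using 1
    rw [hb s hs]; ring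
  · intro s hs
    convert! Biharm.smooth_has sc hs using 1
    field_simp [hn s hs]
  · intro s hs
    convert! (Biharm.smooth_has hr hs).mul (Biharm.smooth_has dc hs) using 1
    have h1 := hODEc s hs
    have h2 := hn s hs
    field_simp at h1 ⊢
    linear_combination -h1
  · intro s hs
    have hco : ContinuousOn (fun u => 1 / r u) (Ioo lo hi) :=
      continuousOn_const.div hr.continuousOn hn
    have hsub : uIcc ((lo + hi) / 2) s ⊆ Ioo lo hi := ordConnected_Ioo.uIcc_subset hm hs
    exact intervalIntegral.integral_hasDerivAt_right
      ((hco.mono hsub).intervalIntegrable)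
      (hco.stronglyMeasurableAtFilter hU s hs) (hco.continuousAt (hU.mem_nhds hs))
end

section
/- Let I ⊆ ℝ be an open interval, let x, y, r, c : I → ℝ be smooth with r(τ) > 0 on I, and let a(τ) = A₁τ + A₀ and b(τ) = B₁τ + B₀ be affine functions (A₁, A₀, B₁, B₀ ∈ ℝ). Suppose that on I: x'' = a·r², y'' = b·r², r'' = r + c·r², c'' = c, and x'² + y'² + r'² = r². Then A₁ = A₀ = B₁ = B₀ = 0 and c vanishes identically on I. -/
open Set

set_option linter.all false

open Polynomial in
lemma bh_root_cont (lo hi : ℝ) (hlt : lo < hi) (P Q : ℝ → ℝ[X]) (m n : ℕ) (hm : m ≠ 0)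
    (hP : ∀ t, (P t).natDegree ≤ m) (hQ : ∀ t, (Q t).natDegree ≤ n)
    (aP : ∀ i, AnalyticOnNhd ℝ (fun t => (P t).coeff i) univ)
    (aQ : ∀ i, AnalyticOnNhd ℝ (fun t => (Q t).coeff i) univ)
    (h : ∀ t ∈ Ioo lo hi, ∃ r : ℝ, (P t).eval r = 0 ∧ (Q t).eval r = 0)
    (t : ℝ) (ht : (P t).coeff m ≠ 0) :
    ∃ z : ℂ, ((P t).map (algebraMap ℝ ℂ)).eval z = 0 ∧
      ((Q t).map (algebraMap ℝ ℂ)).eval z = 0 := by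
  have key : ∀ t, (P t).resultant (Q t) m n = 0 := by
    have an : AnalyticOnNhd ℝ (fun t => (P t).resultant (Q t) m n) univ := by
      intro s _
      simp only [resultant, Matrix.det_apply]
      refine Finset.analyticAt_fun_sum _ fun σ _ => ?_
      simp only [Units.smul_def, zsmul_eq_mul]
      refine AnalyticAt.mul analyticAt_const ?_
      refine Finset.analyticAt_fun_prod _ fun i _ => ?_
      simp only [sylvester, Matrix.of_apply]
      induction i using Fin.addCases with
      | left j =>
        simp only [Fin.addCases_left]
        split_ifs
        · exact aQ _ s trivial
        · exact analyticAt_const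
      | right j =>
        simp only [Fin.addCases_right]
        split_ifs
        · exact aP _ s trivial
        · exact analyticAt_const
    have h0 : ∀ t ∈ Ioo lo hi, (P t).resultant (Q t) m n = 0 := by
      intro t ht
      obtain ⟨r, h1, h2⟩ := h t ht
      obtain ⟨p, q, -, -, e⟩ := exists_mul_add_mul_eq_C_resultant (P t) (Q t) (hP t) (hQ t)
        (Or.inl hm)
      have := congrArg (eval r) e
      simp [h1, h2] at this
      exact this.symm
    have hmid : (lo + hi) / 2 ∈ Ioo lo hi := ⟨by linarith, by linarith⟩
    have := an.eqOn_zero_of_preconnected_of_eventuallyEq_zero isPreconnected_univ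
      (mem_univ ((lo + hi) / 2))
      (Filter.eventually_of_mem (Ioo_mem_nhds hmid.1 hmid.2) h0)
    intro t
    exact this (mem_univ t)
  have hd : (P t).natDegree = m := le_antisymm (hP t) (le_natDegree_of_ne_zero ht)
  have h1 := resultant_map_map (P t) (Q t) m n (algebraMap ℝ ℂ)
  rw [key t, map_zero] at h1
  have hd' : ((P t).map (algebraMap ℝ ℂ)).natDegree = m := by
    rw [natDegree_map, hd]
  have h2 := resultant_eq_prod_eval ((P t).map (algebraMap ℝ ℂ)) ((Q t).map (algebraMap ℝ ℂ)) n
    (by rw [natDegree_map]; exact hQ t) (IsAlgClosed.splits _)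
  rw [hd', h1] at h2
  have hne : (P t).map (algebraMap ℝ ℂ) ≠ 0 := by
    intro h; rw [h] at hd'; simp at hd'; exact hm hd'.symm
  have h3 := (mul_eq_zero.mp h2.symm).resolve_left
    (pow_ne_zero _ (leadingCoeff_ne_zero.mpr hne))
  rw [Multiset.prod_eq_zero_iff, Multiset.mem_map] at h3
  obtain ⟨z, hz, hz2⟩ := h3
  exact ⟨z, (mem_roots hne).mp hz, hz2⟩

open Polynomial in
lemma bh_root_cont4 (lo hi : ℝ) (hlt : lo < hi) (g0 g1 g2 g3 g4 e0 e1 e2 e3 e4 : ℝ → ℝ)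
    (ag0 : AnalyticOnNhd ℝ g0 univ) (ag1 : AnalyticOnNhd ℝ g1 univ)
    (ag2 : AnalyticOnNhd ℝ g2 univ) (ag3 : AnalyticOnNhd ℝ g3 univ)
    (ag4 : AnalyticOnNhd ℝ g4 univ)
    (ae0 : AnalyticOnNhd ℝ e0 univ) (ae1 : AnalyticOnNhd ℝ e1 univ)
    (ae2 : AnalyticOnNhd ℝ e2 univ) (ae3 : AnalyticOnNhd ℝ e3 univ)
    (ae4 : AnalyticOnNhd ℝ e4 univ)
    (h : ∀ t ∈ Ioo lo hi, ∃ r : ℝ,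
      g0 t + g1 t * r + g2 t * r ^ 2 + g3 t * r ^ 3 + g4 t * r ^ 4 = 0 ∧
      e0 t + e1 t * r + e2 t * r ^ 2 + e3 t * r ^ 3 + e4 t * r ^ 4 = 0)
    (t : ℝ) (ht : g4 t ≠ 0) :
    ∃ z : ℂ, (g0 t : ℂ) + g1 t * z + g2 t * z ^ 2 + g3 t * z ^ 3 + g4 t * z ^ 4 = 0 ∧
      (e0 t : ℂ) + e1 t * z + e2 t * z ^ 2 + e3 t * z ^ 3 + e4 t * z ^ 4 = 0 := by
  have hdeg : ∀ a b c d e : ℝ, (C a + C b * X + C c * X ^ 2 + C d * X ^ 3 + C e * X ^ 4 :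
      ℝ[X]).natDegree ≤ 4 := by
    intro a b c d e; compute_degree
  have han : ∀ a b c d e : ℝ → ℝ, AnalyticOnNhd ℝ a univ → AnalyticOnNhd ℝ b univ →
      AnalyticOnNhd ℝ c univ → AnalyticOnNhd ℝ d univ → AnalyticOnNhd ℝ e univ →
      ∀ i, AnalyticOnNhd ℝ (fun t => (C (a t) + C (b t) * X + C (c t) * X ^ 2
        + C (d t) * X ^ 3 + C (e t) * X ^ 4 : ℝ[X]).coeff i) univ := by
    intro a b c d e ha hb hc hd he i
    have hk : ∀ (u : ℝ → ℝ) (v : ℝ), AnalyticOnNhd ℝ u univ →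
        AnalyticOnNhd ℝ (fun t => u t * v) univ := fun u v hu => hu.mul analyticOnNhd_const
    simp only [coeff_add, coeff_C_mul]
    refine AnalyticOnNhd.add (AnalyticOnNhd.add (AnalyticOnNhd.add (AnalyticOnNhd.add ?_
      (hk _ _ hb)) (hk _ _ hc)) (hk _ _ hd)) (hk _ _ he)
    simp only [coeff_C]
    split_ifs
    · exact ha
    · exact analyticOnNhd_const
  obtain ⟨z, h1, h2⟩ := bh_root_cont lo hi hlt
    (fun t => C (g0 t) + C (g1 t) * X + C (g2 t) * X ^ 2 + C (g3 t) * X ^ 3 + C (g4 t) * X ^ 4)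
    (fun t => C (e0 t) + C (e1 t) * X + C (e2 t) * X ^ 2 + C (e3 t) * X ^ 3 + C (e4 t) * X ^ 4)
    4 4 (by norm_num) (fun t => hdeg _ _ _ _ _) (fun t => hdeg _ _ _ _ _)
    (han _ _ _ _ _ ag0 ag1 ag2 ag3 ag4) (han _ _ _ _ _ ae0 ae1 ae2 ae3 ae4)
    (by
      intro t ht
      obtain ⟨r, h1, h2⟩ := h t ht
      exact ⟨r, by simpa using h1, by simpa using h2⟩)
    t (by
      simpa [coeff_C, coeff_X] using ht)
  exact ⟨z, by simpa using h1, by simpa using h2⟩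

/-- First algebraic relation. -/
def bhG {F : Type*} [Field F] (c d M p m r : F) : F :=
  2 * (1 + c * r) * (c + (M + c ^ 2) * r) ^ 3
  - (4 * d + 10 * (p + c * d) * r) * (d + 3 / 2 * (p + c * d) * r) * (c + (M + c ^ 2) * r)
  + 2 * (M + c ^ 2) * r * (d + 3 / 2 * (p + c * d) * r) ^ 2
  + (2 * c + 3 * (m + d ^ 2 + c ^ 2) * r) * (c + (M + c ^ 2) * r) ^ 2

/-- Second algebraic relation. -/
def bhE {F : Type*} [Field F] (c d M p m r : F) : F :=
  m * c ^ 2 * (d + 3 / 2 * (p + c * d) * r) ^ 2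
  + 2 * p * c * (d + 3 / 2 * (p + c * d) * r)
    * ((c + (M + c ^ 2) * r) ^ 2 - d * (d + 3 / 2 * (p + c * d) * r))
  + M * ((c + (M + c ^ 2) * r) ^ 2 - d * (d + 3 / 2 * (p + c * d) * r)) ^ 2
  - (m * M - p ^ 2) * ((c + (M + c ^ 2) * r) ^ 2 - (d + 3 / 2 * (p + c * d) * r) ^ 2)

def bhg0 {F : Type*} [Field F] (c d : F) : F := 4 * c * (c ^ 2 - d ^ 2)
def bhg1 {F : Type*} [Field F] (c d M p m : F) : F :=
  15 * c ^ 2 * (c ^ 2 - d ^ 2) + 10 * c ^ 2 * M - 16 * c * d * p - 2 * d ^ 2 * M + 3 * m * c ^ 2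
def bhg2 {F : Type*} [Field F] (c d M p m : F) : F :=
  2 * (3 * c * (M + c ^ 2) ^ 2 + 3 * c ^ 3 * (M + c ^ 2))
  - 10 * (p + c * d) * (d * (M + c ^ 2) + 3 / 2 * (p + c * d) * c)
  + 2 * c * (M + c ^ 2) ^ 2 + 6 * (m + d ^ 2 + c ^ 2) * c * (M + c ^ 2)
def bhg3 {F : Type*} [Field F] (c d M p m : F) : F :=
  2 * ((M + c ^ 2) ^ 3 + 3 * c ^ 2 * (M + c ^ 2) ^ 2) - 15 * (p + c * d) ^ 2 * (M + c ^ 2)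
  + 9 / 2 * (M + c ^ 2) * (p + c * d) ^ 2 + 3 * (m + d ^ 2 + c ^ 2) * (M + c ^ 2) ^ 2
def bhg4 {F : Type*} [Field F] (c M : F) : F := 2 * c * (M + c ^ 2) ^ 3

lemma bhG_eq {F : Type*} [Field F] [CharZero F] (c d M p m r : F) :
    bhG c d M p m r = bhg0 c d + bhg1 c d M p m * r + bhg2 c d M p m * r ^ 2
      + bhg3 c d M p m * r ^ 3 + bhg4 c M * r ^ 4 := by
  unfold bhG bhg0 bhg1 bhg2 bhg3 bhg4
  field_simp
  ring

lemma bhE_eq {F : Type*} [Field F] [CharZero F] (c d M p m r : F) :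
    bhE c d M p m r =
      (m * c ^ 2 * d ^ 2 + 2 * p * c * d * (c ^ 2 - d ^ 2) + M * (c ^ 2 - d ^ 2) ^ 2
        - (m * M - p ^ 2) * (c ^ 2 - d ^ 2))
      + (m * c ^ 2 * (3 * d * (p + c * d))
        + 2 * p * c * (d * (2 * c * (M + c ^ 2) - d * (3 / 2 * (p + c * d)))
          + 3 / 2 * (p + c * d) * (c ^ 2 - d ^ 2))
        + 2 * M * (c ^ 2 - d ^ 2) * (2 * c * (M + c ^ 2) - d * (3 / 2 * (p + c * d)))
        - (m * M - p ^ 2) * (2 * c * (M + c ^ 2) - 3 * d * (p + c * d))) * r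
      + (m * c ^ 2 * (3 / 2 * (p + c * d)) ^ 2
        + 2 * p * c * (d * (M + c ^ 2) ^ 2
          + 3 / 2 * (p + c * d) * (2 * c * (M + c ^ 2) - d * (3 / 2 * (p + c * d))))
        + M * (2 * (c ^ 2 - d ^ 2) * (M + c ^ 2) ^ 2
          + (2 * c * (M + c ^ 2) - d * (3 / 2 * (p + c * d))) ^ 2)
        - (m * M - p ^ 2) * ((M + c ^ 2) ^ 2 - (3 / 2 * (p + c * d)) ^ 2)) * r ^ 2
      + (2 * p * c * (3 / 2 * (p + c * d)) * (M + c ^ 2) ^ 2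
        + 2 * M * (2 * c * (M + c ^ 2) - d * (3 / 2 * (p + c * d))) * (M + c ^ 2) ^ 2) * r ^ 3
      + (M * (M + c ^ 2) ^ 4) * r ^ 4 := by
  unfold bhE
  field_simp
  ring

lemma bhG_hom {F : Type*} [Field F] [CharZero F] (c d M p m r : F) (hc : c ≠ 0) :
    bhG c d M p m r = c ^ 3 * bhG 1 (d / c) (M / c ^ 2) (p / c ^ 2) (m / c ^ 2) (c * r) := by
  unfold bhG
  field_simp

lemma bhG_cast (c d M p m : ℝ) (z : ℂ) :
    bhG (c : ℂ) d M p m z = ((bhg0 c d : ℝ) : ℂ) + (bhg1 c d M p m : ℝ) * z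
      + (bhg2 c d M p m : ℝ) * z ^ 2
      + (bhg3 c d M p m : ℝ) * z ^ 3 + (bhg4 c M : ℝ) * z ^ 4 := by
  rw [bhG_eq]
  unfold bhg0 bhg1 bhg2 bhg3 bhg4
  push_cast
  ring

/-- common complex roots for all parameter values -/
lemma bh_roots (lo hi : ℝ) (hlt : lo < hi) (c d M p : ℝ → ℝ) (m : ℝ)
    (ac : AnalyticOnNhd ℝ c univ) (ad : AnalyticOnNhd ℝ d univ)
    (aM : AnalyticOnNhd ℝ M univ) (ap : AnalyticOnNhd ℝ p univ)
    (h : ∀ t ∈ Ioo lo hi, ∃ r : ℝ, bhG (c t) (d t) (M t) (p t) m r = 0 ∧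
      bhE (c t) (d t) (M t) (p t) m r = 0)
    (t : ℝ) (ht : c t ≠ 0) (hM : 0 ≤ M t) :
    ∃ z : ℂ, bhG (c t : ℂ) (d t) (M t) (p t) m z = 0 ∧
      bhE (c t : ℂ) (d t) (M t) (p t) m z = 0 := by
  simp only [bhE_eq] at h ⊢
  simp only [bhG_cast]
  simp only [bhG_eq] at h
  have := bh_root_cont4 lo hi hlt _ _ _ _ _ _ _ _ _ _ ?_ ?_ ?_ ?_ ?_ ?_ ?_ ?_ ?_ ?_ h t ?_
  · obtain ⟨z, h1, h2⟩ := this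
    refine ⟨z, h1, ?_⟩
    push_cast at h2
    exact h2
  on_goal 11 =>
    have : 0 < c t ^ 2 := by positivity
    have : 0 < M t + c t ^ 2 := by positivity
    unfold bhg4
    positivity
  all_goals
    intro s _
    have := ac s trivial
    have := ad s trivial
    have := aM s trivial
    have := ap s trivial
    try unfold bhg0
    try unfold bhg1
    try unfold bhg2
    try unfold bhg3
    try unfold bhg4
    fun_prop

open Filter Topology in
lemma bh_tend5 {U : Filter ℝ} (F : ℂ → ℂ → ℂ → ℂ → ℂ → ℂ)
    (hF : Continuous fun x : ℂ × ℂ × ℂ × ℂ × ℂ => F x.1 x.2.1 x.2.2.1 x.2.2.2.1 x.2.2.2.2)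
    {a b c d e : ℝ → ℂ} {a0 b0 c0 d0 e0 : ℂ}
    (ha : Tendsto a U (𝓝 a0)) (hb : Tendsto b U (𝓝 b0)) (hc : Tendsto c U (𝓝 c0))
    (hd : Tendsto d U (𝓝 d0)) (he : Tendsto e U (𝓝 e0)) :
    Tendsto (fun t => F (a t) (b t) (c t) (d t) (e t)) U (𝓝 (F a0 b0 c0 d0 e0)) :=
  (hF.tendsto (a0, b0, c0, d0, e0)).comp
    (ha.prodMk_nhds (hb.prodMk_nhds (hc.prodMk_nhds (hd.prodMk_nhds he))))

lemma bh_bound (g0 g1 g2 g3 g4 z : ℂ) (h0 : ‖g0‖ ≤ 5) (h1 : ‖g1‖ ≤ 5) (h2 : ‖g2‖ ≤ 5)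
    (h3 : ‖g3‖ ≤ 5) (h4 : 1 ≤ ‖g4‖)
    (h : g0 + g1 * z + g2 * z ^ 2 + g3 * z ^ 3 + g4 * z ^ 4 = 0) : ‖z‖ ≤ 20 := by
  by_contra! hz
  have e : g4 * z ^ 4 = -(g0 + g1 * z + g2 * z ^ 2 + g3 * z ^ 3) := by linear_combination h
  have e1 : ‖g4‖ * ‖z‖ ^ 4 ≤ ‖g0‖ + ‖g1‖ * ‖z‖ + ‖g2‖ * ‖z‖ ^ 2 + ‖g3‖ * ‖z‖ ^ 3 := by
    calc ‖g4‖ * ‖z‖ ^ 4 = ‖g4 * z ^ 4‖ := by simp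
      _ = ‖g0 + g1 * z + g2 * z ^ 2 + g3 * z ^ 3‖ := by rw [e, norm_neg]
      _ ≤ ‖g0‖ + ‖g1 * z‖ + ‖g2 * z ^ 2‖ + ‖g3 * z ^ 3‖ := by
        refine (norm_add_le _ _).trans (add_le_add ?_ le_rfl)
        refine (norm_add_le _ _).trans (add_le_add ?_ le_rfl)
        exact norm_add_le _ _
      _ = _ := by simp
  set x := ‖z‖
  have : x ^ 4 ≤ ‖g4‖ * x ^ 4 := le_mul_of_one_le_left (by positivity) h4
  have : ‖g1‖ * x ≤ 5 * x := by gcongr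
  have : ‖g2‖ * x ^ 2 ≤ 5 * x ^ 2 := by gcongr
  have : ‖g3‖ * x ^ 3 ≤ 5 * x ^ 3 := by gcongr
  have hx2 : x ≤ x ^ 3 := by nlinarith [sq_nonneg x]
  have hx3 : x ^ 2 ≤ x ^ 3 := by nlinarith [sq_nonneg x]
  have hx4 : 1 < x ^ 3 := by nlinarith
  have : x ^ 4 ≤ 20 * x ^ 3 := by linarith
  nlinarith [pow_pos (show 0 < x by linarith) 3]

open Filter Topology in
lemma bh_asym (U : Ultrafilter ℝ) (hU : (U : Filter ℝ) ≤ atTop) (κ e : ℝ → ℝ) (z : ℝ → ℂ)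
    (m q n k : ℝ) (hmn : m = 0 → q = 0 ∧ n ≠ 0)
    (hκ : Tendsto κ U (𝓝 1)) (he : ∀ j : ℕ, Tendsto (fun t => t ^ j * e t) U (𝓝 0))
    (hk : ∀ᶠ t in (U : Filter ℝ), 1 - κ t ^ 2 = k * e t ∧ e t ≠ 0)
    (hG : ∀ᶠ t in (U : Filter ℝ), bhG 1 (κ t : ℂ) ((m * t ^ 2 + 2 * q * t + n) * e t)
      ((m * t + q) * e t) (m * e t) (z t) = 0)
    (hE : ∀ᶠ t in (U : Filter ℝ), ∀ w Q v : ℂ,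
      w = 1 + ((m * t ^ 2 + 2 * q * t + n) * e t + 1) * z t →
      Q = κ t + 3 / 2 * ((m * t + q) * e t + κ t) * z t →
      v = w ^ 2 - κ t * Q →
      m * Q ^ 2 + 2 * (m * t + q) * Q * v + (m * t ^ 2 + 2 * q * t + n) * v ^ 2
        - (m * n - q ^ 2) * e t * (w ^ 2 - Q ^ 2) = 0) :
    m = 0 ∧ k = 0 := by
  set K : ℝ → ℂ := fun t => κ t with hKd
  set μ : ℝ → ℂ := fun t => (m * t ^ 2 + 2 * q * t + n) * e t with hμd
  set π : ℝ → ℂ := fun t => (m * t + q) * e t with hπd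
  set ν : ℝ → ℂ := fun t => m * e t with hνd
  have tK : Tendsto K U (𝓝 1) := by
    have := (Complex.continuous_ofReal.tendsto 1).comp hκ
    simpa [Function.comp_def] using this
  have te : ∀ j : ℕ, Tendsto (fun t : ℝ => (t : ℂ) ^ j * (e t : ℂ)) U (𝓝 0) := by
    intro j
    have := (Complex.continuous_ofReal.tendsto 0).comp (he j)
    simpa [Function.comp_def] using this
  have tinv : Tendsto (fun t : ℝ => (t : ℂ)⁻¹) U (𝓝 0) := by
    have h1 : Tendsto (fun t : ℝ => t⁻¹) U (𝓝 0) := tendsto_inv_atTop_zero.mono_left hU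
    have := (Complex.continuous_ofReal.tendsto 0).comp h1
    simpa [Function.comp_def] using this
  have tμ2 : ∀ j : ℕ, Tendsto (fun t : ℝ => (t : ℂ) ^ j * μ t) U (𝓝 0) := by
    intro j
    have := (((te (j + 2)).const_mul (m : ℂ)).add ((te (j + 1)).const_mul (2 * q : ℂ))).add
      ((te j).const_mul (n : ℂ))
    simp only [mul_zero, add_zero] at this
    refine this.congr fun t => ?_
    simp only [hμd]; ring
  have tπ2 : ∀ j : ℕ, Tendsto (fun t : ℝ => (t : ℂ) ^ j * π t) U (𝓝 0) := by
    intro j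
    have := ((te (j + 1)).const_mul (m : ℂ)).add ((te j).const_mul (q : ℂ))
    simp only [mul_zero, add_zero] at this
    refine this.congr fun t => ?_
    simp only [hπd]; ring
  have tν2 : ∀ j : ℕ, Tendsto (fun t : ℝ => (t : ℂ) ^ j * ν t) U (𝓝 0) := by
    intro j
    have := ((te j).const_mul (m : ℂ))
    simp only [mul_zero] at this
    refine this.congr fun t => ?_
    simp only [hνd]; ring
  have tμ : Tendsto μ U (𝓝 0) := by simpa using tμ2 0
  have tπ : Tendsto π U (𝓝 0) := by simpa using tπ2 0
  have tν : Tendsto ν U (𝓝 0) := by simpa using tν2 0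
  have te0 : Tendsto (fun t => (e t : ℂ)) U (𝓝 0) := by simpa using te 0
  -- coefficients
  have tg0 : Tendsto (fun t => bhg0 1 (K t)) U (𝓝 0) := by
    have := bh_tend5 (fun K _ _ _ _ => bhg0 1 K) (by unfold bhg0; fun_prop) tK tμ tπ tν te0
    convert this using 2; unfold bhg0; norm_num
  have tg1 : Tendsto (fun t => bhg1 1 (K t) (μ t) (π t) (ν t)) U (𝓝 0) := by
    have := bh_tend5 (fun K μ π ν _ => bhg1 1 K μ π ν) (by unfold bhg1; fun_prop) tK tμ tπ tν te0
    convert this using 2; unfold bhg1; norm_num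
  have tg2 : Tendsto (fun t => bhg2 1 (K t) (μ t) (π t) (ν t)) U (𝓝 1) := by
    have := bh_tend5 (fun K μ π ν _ => bhg2 1 K μ π ν) (by unfold bhg2; fun_prop) tK tμ tπ tν te0
    convert this using 2; unfold bhg2; norm_num
  have tg3 : Tendsto (fun t => bhg3 1 (K t) (μ t) (π t) (ν t)) U (𝓝 (7 / 2)) := by
    have := bh_tend5 (fun K μ π ν _ => bhg3 1 K μ π ν) (by unfold bhg3; fun_prop) tK tμ tπ tν te0
    convert this using 2; unfold bhg3; norm_num
  have tg4 : Tendsto (fun t => bhg4 1 (μ t)) U (𝓝 2) := by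
    have := bh_tend5 (fun K μ π ν _ => bhg4 1 μ) (by unfold bhg4; fun_prop) tK tμ tπ tν te0
    convert this using 2; unfold bhg4; norm_num
  have hG' : ∀ᶠ t in (U : Filter ℝ), bhg0 1 (K t) + bhg1 1 (K t) (μ t) (π t) (ν t) * z t
      + bhg2 1 (K t) (μ t) (π t) (ν t) * z t ^ 2 + bhg3 1 (K t) (μ t) (π t) (ν t) * z t ^ 3
      + bhg4 1 (μ t) * z t ^ 4 = 0 := by
    filter_upwards [hG] with t ht
    rw [bhG_eq] at ht
    exact ht
  -- boundedness
  have hb : ∀ᶠ t in (U : Filter ℝ), z t ∈ Metric.closedBall (0 : ℂ) 20 := by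
    have b0 := tg0.norm.eventually (eventually_le_nhds (b := 5) (by norm_num))
    have b1 := tg1.norm.eventually (eventually_le_nhds (b := 5) (by norm_num))
    have b2 := tg2.norm.eventually (eventually_le_nhds (b := 5) (by norm_num))
    have b3 := tg3.norm.eventually (eventually_le_nhds (b := 5) (by norm_num))
    have b4 := tg4.norm.eventually (eventually_ge_nhds (b := 1) (by norm_num))
    filter_upwards [b0, b1, b2, b3, b4, hG'] with t h0 h1 h2 h3 h4 h
    rw [mem_closedBall_zero_iff]
    exact bh_bound _ _ _ _ _ _ h0 h1 h2 h3 h4 h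
  obtain ⟨z0, -, hz0⟩ := (isCompact_closedBall (0 : ℂ) 20).ultrafilter_le_nhds (U.map z)
    (by rw [le_principal_iff]; exact hb)
  have tz : Tendsto z U (𝓝 z0) := hz0
  have lim_eq : ∀ {f : ℝ → ℂ} {a : ℂ}, Tendsto f U (𝓝 a) →
      (∀ᶠ t in (U : Filter ℝ), f t = 0) → a = 0 := by
    intro f a hf h0
    exact tendsto_nhds_unique hf (tendsto_const_nhds.congr' (h0.mono fun t ht => ht.symm))
  have hz1 : z0 ^ 2 * (2 * z0 ^ 2 + 7 / 2 * z0 + 1) = 0 := by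
    have := (((tg0.add (tg1.mul tz)).add (tg2.mul (tz.pow 2))).add (tg3.mul (tz.pow 3))).add
      (tg4.mul (tz.pow 4))
    have := lim_eq this hG'
    linear_combination this
  set w : ℝ → ℂ := fun t => 1 + (μ t + 1) * z t with hw
  set Q : ℝ → ℂ := fun t => K t + 3 / 2 * (π t + K t) * z t with hQ
  set s : ℝ → ℂ := fun t => 2 * (μ t + 1) - 3 / 2 * K t * (π t + K t) + (μ t + 1) ^ 2 * z t with hs
  set v : ℝ → ℂ := fun t => w t ^ 2 - K t * Q t with hv
  have tw : Tendsto w U (𝓝 (1 + z0)) := by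
    have := bh_tend5 (fun K μ π ν z => 1 + (μ + 1) * z) (by fun_prop) tK tμ tπ tν tz
    simpa using this
  have tQ : Tendsto Q U (𝓝 (1 + 3 / 2 * z0)) := by
    have := bh_tend5 (fun K μ π ν z => K + 3 / 2 * (π + K) * z) (by fun_prop) tK tμ tπ tν tz
    simpa using this
  have ts : Tendsto s U (𝓝 (1 / 2 + z0)) := by
    have := bh_tend5 (fun K μ π ν z => 2 * (μ + 1) - 3 / 2 * K * (π + K) + (μ + 1) ^ 2 * z)
      (by fun_prop) tK tμ tπ tν tz
    convert this using 2; norm_num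
  have tv : Tendsto v U (𝓝 ((1 + z0) ^ 2 - (1 + 3 / 2 * z0))) := by
    have := (tw.pow 2).sub (tK.mul tQ)
    simpa using this
  have hk' : ∀ᶠ t in (U : Filter ℝ), 1 - K t ^ 2 = k * e t := by
    filter_upwards [hk] with t ht
    have := congrArg (fun x : ℝ => (x : ℂ)) ht.1
    push_cast at this
    exact this
  have hv' : ∀ᶠ t in (U : Filter ℝ), v t = k * e t + z t * s t := by
    filter_upwards [hk'] with t ht
    rw [← ht]
    simp only [hv, hw, hQ, hs]
    ring
  have hE' : ∀ᶠ t in (U : Filter ℝ), m * Q t ^ 2 + 2 * (m * t + q) * Q t * v t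
      + (m * t ^ 2 + 2 * q * t + n) * v t ^ 2
        - (m * n - q ^ 2) * e t * (w t ^ 2 - Q t ^ 2) = 0 := by
    filter_upwards [hE] with t ht
    exact ht _ _ _ rfl rfl rfl
  have hpos : ∀ᶠ t : ℝ in (U : Filter ℝ), (t : ℂ) ≠ 0 := by
    filter_upwards [hU (eventually_gt_atTop 0)] with t ht
    exact_mod_cast ht.ne'
  -- z0 = 0
  have hv0 : (1 + z0) ^ 2 - (1 + 3 / 2 * z0) = 0 := by
    by_cases hm : m = 0
    · obtain ⟨hq, hn⟩ := hmn hm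
      refine lim_eq tv ?_
      filter_upwards [hE'] with t ht
      simp only [hm, hq] at ht
      have hn' : (n : ℂ) ≠ 0 := by exact_mod_cast hn
      simpa [hn'] using ht
    · have t1 : Tendsto (fun t : ℝ => (m : ℂ) + 2 * q * (t : ℂ)⁻¹ + n * (t : ℂ)⁻¹ ^ 2) U
          (𝓝 ((m : ℂ) + 2 * q * 0 + n * 0 ^ 2)) :=
        (tendsto_const_nhds.add (tinv.const_mul _)).add ((tinv.pow 2).const_mul _)
      have t2 : Tendsto (fun t : ℝ => (m : ℂ) * (t : ℂ)⁻¹ + q * (t : ℂ)⁻¹ ^ 2) U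
          (𝓝 ((m : ℂ) * 0 + q * 0 ^ 2)) :=
        (tinv.const_mul _).add ((tinv.pow 2).const_mul _)
      have := ((((tQ.pow 2).const_mul (m : ℂ)).mul (tinv.pow 2)).add
        (((t2.const_mul 2).mul tQ).mul tv)).add (t1.mul (tv.pow 2))
      have := this.sub (((te0.const_mul (m * n - q ^ 2 : ℂ)).mul
        ((tw.pow 2).sub (tQ.pow 2))).mul (tinv.pow 2))
      have := lim_eq this (by
        filter_upwards [hE', hpos] with t ht h0
        have := congrArg (fun x => x * (t : ℂ)⁻¹ ^ 2) ht
        simp only [zero_mul] at this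
        rw [← this]
        field_simp)
      simpa [hm] using this
  have hz00 : z0 = 0 := by
    have h1 : z0 * (z0 + 1 / 2) = 0 := by linear_combination hv0
    rcases mul_eq_zero.mp h1 with h | h
    · exact h
    · have : z0 = -1 / 2 := by linear_combination h
      rw [this] at hz1
      norm_num at hz1
  subst hz00
  have tH : Tendsto (fun t => bhg2 1 (K t) (μ t) (π t) (ν t) + bhg3 1 (K t) (μ t) (π t) (ν t) * z t
      + bhg4 1 (μ t) * z t ^ 2) U (𝓝 1) := by
    have := (tg2.add (tg3.mul tz)).add (tg4.mul (tz.pow 2))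
    simpa using this
  have hm : m = 0 := by
    have t3 : Tendsto (fun t : ℝ => (t : ℂ) ^ 2 * bhg1 1 (K t) (μ t) (π t) (ν t)) U (𝓝 0) := by
      have := ((((te 2).const_mul (15 * k : ℂ)).add ((tμ2 2).const_mul 10)).sub
        ((tK.const_mul 16).mul (tπ2 2))).sub (((tK.pow 2).const_mul 2).mul (tμ2 2))
      have := this.add ((tν2 2).const_mul 3)
      simp only [mul_zero, add_zero, sub_zero] at this
      refine this.congr' ?_
      filter_upwards [hk'] with t ht
      unfold bhg1
      linear_combination (-15) * (t : ℂ) ^ 2 * ht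
    have t4 : Tendsto (fun t : ℝ => ((t : ℂ) * z t) ^ 2) U (𝓝 0) := by
      have h1 := ((((te 2).const_mul (4 * k : ℂ)).add (t3.mul tz)).neg).div tH one_ne_zero
      simp only [mul_zero, add_zero, neg_zero, zero_div] at h1
      refine h1.congr' ?_
      filter_upwards [hk', hG', tH.eventually_ne one_ne_zero] with t h2 h3 h4
      rw [Pi.div_apply, div_eq_iff h4]
      unfold bhg0 at h3
      linear_combination (-(t : ℂ) ^ 2) * h3 + 4 * (t : ℂ) ^ 2 * h2
    have t5 : Tendsto (fun t : ℝ => (t : ℂ) * z t) U (𝓝 0) := by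
      rw [tendsto_zero_iff_norm_tendsto_zero] at t4 ⊢
      have := (Real.continuous_sqrt.tendsto 0).comp t4
      simp only [Real.sqrt_zero] at this
      refine this.congr fun t => ?_
      simp only [Function.comp_apply]
      rw [norm_pow, Real.sqrt_sq (norm_nonneg _)]
    have t6 : Tendsto (fun t : ℝ => (t : ℂ) * v t) U (𝓝 0) := by
      have h1 := ((te 1).const_mul (k : ℂ)).add (t5.mul ts)
      simp only [mul_zero, zero_mul, add_zero] at h1
      refine h1.congr' ?_
      filter_upwards [hv'] with t ht
      rw [ht]; ring
    have t1 : Tendsto (fun t : ℝ => (m : ℂ) + 2 * q * (t : ℂ)⁻¹ + n * (t : ℂ)⁻¹ ^ 2) U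
        (𝓝 ((m : ℂ) + 2 * q * 0 + n * 0 ^ 2)) :=
      (tendsto_const_nhds.add (tinv.const_mul _)).add ((tinv.pow 2).const_mul _)
    have t2 : Tendsto (fun t : ℝ => (m : ℂ) + q * (t : ℂ)⁻¹) U (𝓝 ((m : ℂ) + q * 0)) :=
      tendsto_const_nhds.add (tinv.const_mul _)
    have := (((tQ.pow 2).const_mul (m : ℂ)).add
        (((t2.const_mul 2).mul tQ).mul t6)).add (t1.mul (t6.pow 2))
    have := this.sub ((te0.const_mul (m * n - q ^ 2 : ℂ)).mul
        ((tw.pow 2).sub (tQ.pow 2)))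
    have := lim_eq this (by
        filter_upwards [hE', hpos] with t ht h0
        rw [← ht]
        field_simp)
    simpa using this
  refine ⟨hm, ?_⟩
  obtain ⟨hq, hn⟩ := hmn hm
  have hn' : (n : ℂ) ≠ 0 := by exact_mod_cast hn
  have he0 : ∀ᶠ t in (U : Filter ℝ), (e t : ℂ) ≠ 0 := by
    filter_upwards [hk] with t ht
    exact_mod_cast ht.2
  have tx : Tendsto (fun t => z t / e t) U (𝓝 (-k / (1 / 2 + 0))) := by
    have h1 : Tendsto (fun t => (-k : ℂ) / s t) U (𝓝 (-k / (1 / 2 + 0))) :=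
      tendsto_const_nhds.div ts (by norm_num)
    refine h1.congr' ?_
    filter_upwards [hE', hv', he0, ts.eventually_ne (b₂ := 0) (by norm_num)] with t h2 h3 h4 h5
    simp only [hm, hq] at h2
    have h6 : v t = 0 := by simpa [hn'] using h2
    rw [div_eq_div_iff h5 h4]
    rw [h6] at h3
    linear_combination h3
  have := ((tx.mul tg1).add ((tx.mul tz).mul tH)).const_add (4 * k : ℂ)
  have := lim_eq this (by
    filter_upwards [hG', he0, hk'] with t h1 h2 h3
    have h4 : bhg0 1 (K t) = 4 * k * e t := by
      unfold bhg0; linear_combination 4 * h3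
    rw [h4] at h1
    field_simp
    linear_combination h1)
  simpa using this

lemma bhE_hom {F : Type*} [Field F] [CharZero F] (c d M p m r w Q v : F) (hc : c ≠ 0)
    (hw : w = 1 + (M * (1 / c ^ 2) + 1) * (c * r))
    (hQ : Q = d / c + 3 / 2 * (p * (1 / c ^ 2) + d / c) * (c * r))
    (hv : v = w ^ 2 - d / c * Q) :
    bhE c d M p m r = c ^ 4 * (m * Q ^ 2 + 2 * p * Q * v + M * v ^ 2
      - (m * M - p ^ 2) * (1 / c ^ 2) * (w ^ 2 - Q ^ 2)) := by
  have h1 : c + (M + c ^ 2) * r = c * w := by rw [hw]; field_simp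
  have h2 : d + 3 / 2 * (p + c * d) * r = c * Q := by rw [hQ]; field_simp
  unfold bhE
  rw [h1, h2]
  have h3 : (c * w) ^ 2 - d * (c * Q) = c ^ 2 * v := by rw [hv]; field_simp
  rw [h3]
  field_simp

open Filter Topology in
lemma bh_half (lo hi : ℝ) (hlt : lo < hi) (m q n α β : ℝ) (hα : α ≠ 0)
    (hM : ∀ t : ℝ, 0 ≤ m * t ^ 2 + 2 * q * t + n) (hmn : m = 0 → q = 0 ∧ n ≠ 0)
    (h : ∀ t ∈ Ioo lo hi, ∃ r : ℝ,
      bhG (α * Real.exp t + β * Real.exp (-t)) (α * Real.exp t - β * Real.exp (-t))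
        (m * t ^ 2 + 2 * q * t + n) (m * t + q) m r = 0 ∧
      bhE (α * Real.exp t + β * Real.exp (-t)) (α * Real.exp t - β * Real.exp (-t))
        (m * t ^ 2 + 2 * q * t + n) (m * t + q) m r = 0) :
    m = 0 ∧ α * β = 0 := by
  set c : ℝ → ℝ := fun t => α * Real.exp t + β * Real.exp (-t) with hc
  set d : ℝ → ℝ := fun t => α * Real.exp t - β * Real.exp (-t) with hd
  have hroots := bh_roots lo hi hlt c d (fun t => m * t ^ 2 + 2 * q * t + n)
    (fun t => m * t + q) m (by intro s _; simp only [hc]; fun_prop)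
    (by intro s _; simp only [hd]; fun_prop) (by intro s _; fun_prop)
    (by intro s _; fun_prop) h
  have hz : ∀ t, ∃ z : ℂ, c t ≠ 0 →
      bhG (c t : ℂ) (d t) (m * t ^ 2 + 2 * q * t + n : ℝ) (m * t + q : ℝ) m z = 0 ∧
      bhE (c t : ℂ) (d t) (m * t ^ 2 + 2 * q * t + n : ℝ) (m * t + q : ℝ) m z = 0 := by
    intro t
    by_cases h0 : c t = 0
    · exact ⟨0, fun h => absurd h0 h⟩
    · obtain ⟨z, h1⟩ := hroots t h0 (hM t)
      exact ⟨z, fun _ => h1⟩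
  choose ρ hρ using hz
  have texp : Tendsto (fun t : ℝ => Real.exp (-t)) atTop (𝓝 0) :=
    Real.tendsto_exp_neg_atTop_nhds_zero
  have tcn : Tendsto (fun t => α + β * Real.exp (-t) ^ 2) atTop (𝓝 α) := by
    have := (((texp.pow 2).const_mul β).const_add α)
    simpa using this
  have tdn : Tendsto (fun t => α - β * Real.exp (-t) ^ 2) atTop (𝓝 α) := by
    have := (((texp.pow 2).const_mul β).const_sub α)
    simpa using this
  have hcn : ∀ t, c t = Real.exp t * (α + β * Real.exp (-t) ^ 2) := by
    intro t
    have : Real.exp t * Real.exp (-t) = 1 := by rw [← Real.exp_add]; simp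
    simp only [hc]
    linear_combination (-β * Real.exp (-t)) * this
  have hdn : ∀ t, d t = Real.exp t * (α - β * Real.exp (-t) ^ 2) := by
    intro t
    have : Real.exp t * Real.exp (-t) = 1 := by rw [← Real.exp_add]; simp
    simp only [hd]
    linear_combination (β * Real.exp (-t)) * this
  have hc0 : ∀ᶠ t in atTop, c t ≠ 0 := by
    filter_upwards [tcn.eventually_ne hα] with t ht
    rw [hcn]
    exact mul_ne_zero (Real.exp_pos t).ne' ht
  have hU : ((Ultrafilter.of atTop : Ultrafilter ℝ) : Filter ℝ) ≤ atTop := Ultrafilter.of_le _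
  have key := bh_asym (Ultrafilter.of atTop) hU (fun t => d t / c t) (fun t => 1 / c t ^ 2)
    (fun t => c t * ρ t) m q n (4 * α * β) hmn ?_ ?_ ?_ ?_ ?_
  · refine ⟨key.1, ?_⟩
    linarith [key.2]
  · refine Tendsto.mono_left ?_ hU
    have := tdn.div tcn hα
    rw [div_self hα] at this
    refine this.congr fun t => ?_
    rw [Pi.div_apply, hcn, hdn, mul_div_mul_left _ _ (Real.exp_pos t).ne']
  · intro j
    refine Tendsto.mono_left ?_ hU
    have h1 := (Real.tendsto_pow_mul_exp_neg_atTop_nhds_zero j).mul texp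
    have := h1.div (tcn.pow 2) (pow_ne_zero 2 hα)
    simp only [mul_zero, zero_div] at this
    refine this.congr fun t => ?_
    rw [Pi.div_apply, hcn, Real.exp_neg]
    have := (Real.exp_pos t).ne'
    field_simp
  · filter_upwards [hU hc0] with t ht
    refine ⟨?_, by positivity⟩
    have : Real.exp t * Real.exp (-t) = 1 := by rw [← Real.exp_add]; simp
    field_simp
    simp only [hc, hd]
    linear_combination (4 * α * β) * this
  · filter_upwards [hU hc0] with t ht
    have h1 := (hρ t ht).1
    have hct : (c t : ℂ) ≠ 0 := by exact_mod_cast ht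
    rw [bhG_hom _ _ _ _ _ _ hct] at h1
    have h2 := (mul_eq_zero.mp h1).resolve_left (pow_ne_zero 3 hct)
    push_cast at h2 ⊢
    simpa only [div_eq_mul_inv, one_mul] using h2
  · filter_upwards [hU hc0] with t ht
    intro w Q v hw hQ hv
    have h1 := (hρ t ht).2
    have hct : (c t : ℂ) ≠ 0 := by exact_mod_cast ht
    push_cast at hw hQ hv h1 ⊢
    rw [bhE_hom _ _ _ _ _ _ w Q v hct hw hQ hv] at h1
    have h2 := (mul_eq_zero.mp h1).resolve_left (pow_ne_zero 4 hct)
    rw [← h2]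
    ring

lemma bh_k0 (c d M r : ℝ) (hc : c ≠ 0) (hd : d ^ 2 = c ^ 2) (hM : 0 < M) (hr : r ≠ 0)
    (hG : bhG c d M 0 0 r = 0) (hE : bhE c d M 0 0 r = 0) : c ^ 2 = 2 * M := by
  have hV : (c + (M + c ^ 2) * r) ^ 2 - d * (d + 3 / 2 * (0 + c * d) * r) = 0 := by
    have : M * ((c + (M + c ^ 2) * r) ^ 2 - d * (d + 3 / 2 * (0 + c * d) * r)) ^ 2 = 0 := by
      have h := hE
      unfold bhE at h
      linear_combination h
    exact pow_eq_zero_iff (two_ne_zero) |>.mp ((mul_eq_zero.mp this).resolve_left hM.ne')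
  have h1 : (M + c ^ 2) ^ 2 * r = -(c ^ 3 / 2 + 2 * c * M) := by
    have : r * ((M + c ^ 2) ^ 2 * r + (c ^ 3 / 2 + 2 * c * M)) = 0 := by
      linear_combination hV + (1 + 3 / 2 * c * r) * hd
    have := (mul_eq_zero.mp this).resolve_left hr
    linarith
  have h2 : r * (8 * c ^ 2 * M + (8 * c * (M + c ^ 2) ^ 2 + 8 * c ^ 3 * (M + c ^ 2) - 15 * c ^ 5) * r
      + (2 * (M + c ^ 2) ^ 3 + 12 * c ^ 2 * (M + c ^ 2) ^ 2 - 21 / 2 * c ^ 4 * (M + c ^ 2)) * r ^ 2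
      + 2 * c * (M + c ^ 2) ^ 3 * r ^ 3) = 0 := by
    rw [← hG, bhG_eq]
    unfold bhg0 bhg1 bhg2 bhg3 bhg4
    rcases sq_eq_sq_iff_eq_or_eq_neg.mp hd with rfl | rfl <;> ring
  have h3 := (mul_eq_zero.mp h2).resolve_left hr
  have h4 : 8 * c ^ 2 * M * (M + c ^ 2) ^ 4
      + (8 * c * (M + c ^ 2) ^ 2 + 8 * c ^ 3 * (M + c ^ 2) - 15 * c ^ 5) * (M + c ^ 2) ^ 2
        * ((M + c ^ 2) ^ 2 * r)
      + (2 * (M + c ^ 2) ^ 3 + 12 * c ^ 2 * (M + c ^ 2) ^ 2 - 21 / 2 * c ^ 4 * (M + c ^ 2))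
        * ((M + c ^ 2) ^ 2 * r) ^ 2
      + 2 * c * (M + c ^ 2) * ((M + c ^ 2) ^ 2 * r) ^ 3 = 0 := by
    linear_combination (M + c ^ 2) ^ 4 * h3
  rw [h1] at h4
  have h5 : (c ^ 4 * (M + c ^ 2) * (c ^ 2 + 16 * M)) * (c ^ 2 - 2 * M) ^ 2 = 0 := by
    linear_combination 8 * h4
  have h6 : c ^ 4 * (M + c ^ 2) * (c ^ 2 + 16 * M) ≠ 0 := by positivity
  have h7 := pow_eq_zero_iff (two_ne_zero) |>.mp ((mul_eq_zero.mp h5).resolve_left h6)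
  linarith

lemma bh_main_alg (lo hi : ℝ) (hlt : lo < hi) (m q n α β : ℝ)
    (hM : ∀ t : ℝ, 0 ≤ m * t ^ 2 + 2 * q * t + n) (hmn : m = 0 → q = 0 ∧ n ≠ 0)
    (hm : 0 ≤ m) (hmq : q ^ 2 ≤ m * n)
    (h : ∀ t ∈ Ioo lo hi, ∃ r : ℝ, 0 < r ∧
      bhG (α * Real.exp t + β * Real.exp (-t)) (α * Real.exp t - β * Real.exp (-t))
        (m * t ^ 2 + 2 * q * t + n) (m * t + q) m r = 0 ∧
      bhE (α * Real.exp t + β * Real.exp (-t)) (α * Real.exp t - β * Real.exp (-t))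
        (m * t ^ 2 + 2 * q * t + n) (m * t + q) m r = 0) : False := by
  by_cases h0 : α = 0 ∧ β = 0
  · obtain ⟨rfl, rfl⟩ := h0
    set f : ℝ → ℝ := fun t => (m * t ^ 2 + 2 * q * t + n) * (2 * (m * t ^ 2 + 2 * q * t + n) ^ 2
        - 21 / 2 * (m * t + q) ^ 2 + 3 * m * (m * t ^ 2 + 2 * q * t + n)) with hf
    have h1 : ∀ t ∈ Ioo lo hi, f t = 0 := by
      intro t ht
      obtain ⟨r, hr, hG, -⟩ := h t ht
      have : r ^ 3 * f t = 0 := by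
        rw [← hG]; simp only [hf]; unfold bhG; ring
      exact (mul_eq_zero.mp this).resolve_left (by positivity)
    have an : AnalyticOnNhd ℝ f univ := by
      intro s _; simp only [hf]; fun_prop
    have hmid : (lo + hi) / 2 ∈ Ioo lo hi := ⟨by linarith, by linarith⟩
    have h2 := an.eqOn_zero_of_preconnected_of_eventuallyEq_zero isPreconnected_univ
      (mem_univ ((lo + hi) / 2))
      (Filter.eventually_of_mem (Ioo_mem_nhds hmid.1 hmid.2) h1)
    by_cases hm0 : m = 0
    · obtain ⟨rfl, hn⟩ := hmn hm0
      have := h2 (mem_univ 0)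
      simp [hf, hm0, hn] at this
    · have hmp : 0 < m := lt_of_le_of_ne hm (Ne.symm hm0)
      -- evaluate at t = -q/m + 3
      have := h2 (mem_univ (-q / m + 3))
      simp only [hf, Pi.zero_apply] at this
      have e1 : m * (-q / m + 3) + q = 3 * m := by field_simp; ring
      have e2 : m * (-q / m + 3) ^ 2 + 2 * q * (-q / m + 3) + n = 9 * m + (n - q ^ 2 / m) := by
        field_simp; ring
      have e3 : 0 ≤ n - q ^ 2 / m := by
        rw [sub_nonneg, div_le_iff₀ hmp]; linarith
      rw [e1, e2] at this
      set y := n - q ^ 2 / m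
      have hp : 0 < 2 * (9 * m + y) ^ 2 - 21 / 2 * (3 * m) ^ 2 + 3 * m * (9 * m + y) := by
        nlinarith [mul_nonneg hm e3, mul_pos hmp hmp, sq_nonneg y]
      have : 0 < (9 * m + y) *
        (2 * (9 * m + y) ^ 2 - 21 / 2 * (3 * m) ^ 2 + 3 * m * (9 * m + y)) := by positivity
      linarith
  · have hk : m = 0 ∧ α * β = 0 := by
      by_cases hα : α = 0
      · have hβ : β ≠ 0 := fun h => h0 ⟨hα, h⟩
        have := bh_half (-hi) (-lo) (by linarith) m (-q) n β α hβ
          (fun t => by have := hM (-t); nlinarith) (fun h => by simpa using hmn h) (by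
            intro t ht
            obtain ⟨r, -, h1, h2⟩ := h (-t) ⟨by linarith [ht.2], by linarith [ht.1]⟩
            refine ⟨r, ?_, ?_⟩
            · rw [← h1]; unfold bhG; rw [neg_neg]; ring
            · rw [← h2]; unfold bhE; rw [neg_neg]; ring)
        exact ⟨this.1, by rw [hα]; simp⟩
      · exact bh_half lo hi hlt m q n α β hα hM hmn (fun t ht => by
          obtain ⟨r, -, h1⟩ := h t ht; exact ⟨r, h1⟩)
    obtain ⟨rfl, hk⟩ := hk
    obtain ⟨rfl, hn⟩ := hmn rfl
    have hnp : 0 < n := lt_of_le_of_ne (by simpa using hM 0) (Ne.symm hn)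
    have hall : ∀ t ∈ Ioo lo hi, (α * Real.exp t + β * Real.exp (-t)) ^ 2 = 2 * n := by
      intro t ht
      obtain ⟨r, hr, h1, h2⟩ := h t ht
      have e1 : 0 * t ^ 2 + 2 * 0 * t + n = n := by ring
      have e2 : 0 * t + 0 = (0 : ℝ) := by ring
      rw [e1, e2] at h1 h2
      refine bh_k0 _ _ n r ?_ ?_ hnp hr.ne' h1 h2
      · rcases mul_eq_zero.mp hk with h | h
        · have : β ≠ 0 := fun h' => h0 ⟨h, h'⟩
          simp [h, this]
        · have : α ≠ 0 := fun h' => h0 ⟨h', h⟩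
          simp [h, this]
      · linear_combination (-4 * Real.exp t * Real.exp (-t)) * hk
    have e1 := hall ((lo + hi) / 2) ⟨by linarith, by linarith⟩
    have e2 := hall ((lo + 3 * hi) / 4) ⟨by linarith, by linarith⟩
    rw [← e2] at e1
    rcases mul_eq_zero.mp hk with h | h
    · have hβ : β ≠ 0 := fun h' => h0 ⟨h, h'⟩
      rw [h, zero_mul, zero_mul, zero_add, zero_add, mul_pow, mul_pow] at e1
      have e3 := mul_left_cancel₀ (pow_ne_zero 2 hβ) e1
      have e4 := (pow_left_inj₀ (Real.exp_pos _).le (Real.exp_pos _).le two_ne_zero).mp e3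
      have := Real.exp_injective e4
      linarith
    · have hα : α ≠ 0 := fun h' => h0 ⟨h', h⟩
      rw [h, zero_mul, zero_mul, add_zero, add_zero, mul_pow, mul_pow] at e1
      have e3 := mul_left_cancel₀ (pow_ne_zero 2 hα) e1
      have e4 := (pow_left_inj₀ (Real.exp_pos _).le (Real.exp_pos _).le two_ne_zero).mp e3
      have := Real.exp_injective e4
      linarith

lemma bh_point (a b A₁ B₁ c d r s X Y : ℝ) (hr : 0 < r)
    (h0 : X ^ 2 + Y ^ 2 + s ^ 2 = r ^ 2)
    (h1 : a * X + b * Y + c * s = 0)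
    (h2 : A₁ * X + B₁ * Y + d * s + (a ^ 2 + b ^ 2 + c ^ 2) * r ^ 2 + c * r = 0)
    (h3 : 2 * c * s + 2 * d * r + 3 * (A₁ * a + B₁ * b + c * d) * r ^ 2
      + 2 * (a ^ 2 + b ^ 2 + c ^ 2) * r * s = 0)
    (h4 : 4 * d * s + 2 * c * (r + c * r ^ 2) + 2 * c * r
      + 3 * (A₁ ^ 2 + B₁ ^ 2 + d ^ 2 + c ^ 2) * r ^ 2
      + 10 * (A₁ * a + B₁ * b + c * d) * r * s + 2 * (a ^ 2 + b ^ 2 + c ^ 2) * s ^ 2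
      + 2 * (a ^ 2 + b ^ 2 + c ^ 2) * r * (r + c * r ^ 2) = 0) :
    bhG c d (a ^ 2 + b ^ 2) (A₁ * a + B₁ * b) (A₁ ^ 2 + B₁ ^ 2) r = 0 ∧
    bhE c d (a ^ 2 + b ^ 2) (A₁ * a + B₁ * b) (A₁ ^ 2 + B₁ ^ 2) r = 0 := by
  obtain ⟨M, hM⟩ : ∃ M, M = a ^ 2 + b ^ 2 := ⟨_, rfl⟩
  obtain ⟨p, hp⟩ : ∃ p, p = A₁ * a + B₁ * b := ⟨_, rfl⟩
  obtain ⟨m, hm⟩ : ∃ m, m = A₁ ^ 2 + B₁ ^ 2 := ⟨_, rfl⟩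
  obtain ⟨T, hT⟩ : ∃ T, T = d * s + (M + c ^ 2) * r ^ 2 + c * r := ⟨_, rfl⟩
  have e1 : a * X + b * Y = -(c * s) := by linarith
  have e2 : A₁ * X + B₁ * Y = -T := by rw [hT, hM]; linarith
  have hX : (a * B₁ - A₁ * b) * X = b * T - B₁ * c * s := by
    linear_combination B₁ * e1 - b * e2
  have hY : (a * B₁ - A₁ * b) * Y = A₁ * c * s - a * T := by
    linear_combination a * e2 - A₁ * e1
  have key : (m * M - p ^ 2) * (r ^ 2 - s ^ 2)
      = m * c ^ 2 * s ^ 2 - 2 * p * c * s * T + M * T ^ 2 := by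
    have hD : m * M - p ^ 2 = (a * B₁ - A₁ * b) ^ 2 := by rw [hm, hM, hp]; ring
    have : (m * M - p ^ 2) * (r ^ 2 - s ^ 2)
      = ((a * B₁ - A₁ * b) * X) ^ 2 + ((a * B₁ - A₁ * b) * Y) ^ 2 := by
      rw [hD]; linear_combination (-(a * B₁ - A₁ * b) ^ 2) * h0
    rw [this, hX, hY, hm, hp, hM]; ring
  rw [← hM, ← hp] at h3 h4
  rw [← hm] at h4
  rw [← hM, ← hp, ← hm]
  clear hM hp hm e1 e2 hX hY h0 h1 h2
  have hs : s * (c + (M + c ^ 2) * r) = -(r * (d + 3 / 2 * (p + c * d) * r)) := by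
    linear_combination h3 / 2
  constructor
  · have : r * bhG c d M p m r = 0 := by
      unfold bhG
      linear_combination (c + (M + c ^ 2) * r) ^ 2 * h4
        - (4 * d + 10 * (p + c * d) * r) * (c + (M + c ^ 2) * r) * hs
        - 2 * (M + c ^ 2) * (s * (c + (M + c ^ 2) * r) - r * (d + 3 / 2 * (p + c * d) * r)) * hs
    exact (mul_eq_zero.mp this).resolve_left hr.ne'
  · have hTW : T * (c + (M + c ^ 2) * r)
        = r * ((c + (M + c ^ 2) * r) ^ 2 - d * (d + 3 / 2 * (p + c * d) * r)) := by
      rw [hT]; linear_combination d * hs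
    unfold bhE
    generalize (c + (M + c ^ 2) * r) = W at *
    generalize (d + 3 / 2 * (p + c * d) * r) = Q at *
    have k2 : (m * M - p ^ 2) * ((r * W) ^ 2 - (s * W) ^ 2)
      = m * c ^ 2 * (s * W) ^ 2 - 2 * p * c * (s * W) * (T * W) + M * (T * W) ^ 2 := by
      linear_combination W ^ 2 * key
    rw [hs, hTW] at k2
    have : r ^ 2 * (m * c ^ 2 * Q ^ 2 + 2 * p * c * Q * (W ^ 2 - d * Q) + M * (W ^ 2 - d * Q) ^ 2
      - (m * M - p ^ 2) * (W ^ 2 - Q ^ 2)) = 0 := by linear_combination -k2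
    exact (mul_eq_zero.mp this).resolve_left (by positivity)

lemma bh_point0 (c d r s : ℝ) (hr : 0 < r) (h1 : c * s = 0)
    (h2 : d * s + c ^ 2 * r ^ 2 + c * r = 0)
    (h3 : 2 * c * s + 2 * d * r + 3 * (c * d) * r ^ 2 + 2 * c ^ 2 * r * s = 0)
    (h4 : 4 * d * s + 2 * c * (r + c * r ^ 2) + 2 * c * r
      + 3 * (d ^ 2 + c ^ 2) * r ^ 2
      + 10 * (c * d) * r * s + 2 * c ^ 2 * s ^ 2
      + 2 * c ^ 2 * r * (r + c * r ^ 2) = 0) : c = 0 := by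
  by_contra hc
  have hs : s = 0 := (mul_eq_zero.mp h1).resolve_left hc
  subst hs
  have k1 : c * r + 1 = 0 := by
    have : (c * r) * (c * r + 1) = 0 := by linear_combination h2
    exact (mul_eq_zero.mp this).resolve_left (mul_ne_zero hc hr.ne')
  have k2 : d = 0 := by
    have : r * d = 0 := by linear_combination -h3 + 3 * d * r * k1
    exact (mul_eq_zero.mp this).resolve_left hr.ne'
  subst k2
  have hcr : c * r = -1 := by linarith
  have : 4 * (c * r) + 7 * (c * r) ^ 2 + 2 * (c * r) ^ 3 = 0 := by linear_combination h4
  rw [hcr] at this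
  norm_num at this

lemma bh_deriv_zero (lo hi : ℝ) (F F' : ℝ → ℝ) (hF : ∀ t ∈ Ioo lo hi, F t = 0)
    (hd : ∀ t ∈ Ioo lo hi, HasDerivAt F (F' t) t) : ∀ t ∈ Ioo lo hi, F' t = 0 := by
  intro t ht
  have h1 : F =ᶠ[nhds t] fun _ => 0 :=
    Filter.eventually_of_mem (Ioo_mem_nhds ht.1 ht.2) hF
  exact (hd t ht).unique ((hasDerivAt_const t (0 : ℝ)).congr_of_eventuallyEq h1)

lemma bh_const (lo hi : ℝ) (F : ℝ → ℝ)
    (hd : ∀ t ∈ Ioo lo hi, HasDerivAt F 0 t) : ∃ C, ∀ t ∈ Ioo lo hi, F t = C :=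
  isOpen_Ioo.exists_is_const_of_deriv_eq_zero isPreconnected_Ioo
    (fun t ht => (hd t ht).differentiableAt.differentiableWithinAt) (fun t ht => (hd t ht).deriv)

/-- Main theorem in the variable `τ`: the reduced biharmonic system with affine
`a(τ) = A₁τ + A₀`, `b(τ) = B₁τ + B₀` forces `a ≡ b ≡ c ≡ 0`. -/
theorem biharmonic_reduced_system_minimal
    (lo hi : ℝ) (hlt : lo < hi) (x y r c : ℝ → ℝ)
    (hx : ContDiffOn ℝ (⊤ : ℕ∞) x (Ioo lo hi))
    (hy : ContDiffOn ℝ (⊤ : ℕ∞) y (Ioo lo hi))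
    (hr : ContDiffOn ℝ (⊤ : ℕ∞) r (Ioo lo hi))
    (hc : ContDiffOn ℝ (⊤ : ℕ∞) c (Ioo lo hi))
    (hrpos : ∀ τ ∈ Ioo lo hi, 0 < r τ)
    (A₁ A₀ B₁ B₀ : ℝ)
    (hx'' : ∀ τ ∈ Ioo lo hi, deriv (deriv x) τ = (A₁ * τ + A₀) * r τ ^ 2)
    (hy'' : ∀ τ ∈ Ioo lo hi, deriv (deriv y) τ = (B₁ * τ + B₀) * r τ ^ 2)
    (hr'' : ∀ τ ∈ Ioo lo hi, deriv (deriv r) τ = r τ + c τ * r τ ^ 2)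
    (hc'' : ∀ τ ∈ Ioo lo hi, deriv (deriv c) τ = c τ)
    (harc : ∀ τ ∈ Ioo lo hi,
      deriv x τ ^ 2 + deriv y τ ^ 2 + deriv r τ ^ 2 = r τ ^ 2) :
    A₁ = 0 ∧ A₀ = 0 ∧ B₁ = 0 ∧ B₀ = 0 ∧ ∀ τ ∈ Ioo lo hi, c τ = 0 := by
  have d1 : ∀ f : ℝ → ℝ, ContDiffOn ℝ (⊤ : ℕ∞) f (Ioo lo hi) →
      ∀ t ∈ Ioo lo hi, HasDerivAt f (deriv f t) t := by
    intro f hf t ht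
    exact ((hf.contDiffAt (Ioo_mem_nhds ht.1 ht.2)).differentiableAt (by simp)).hasDerivAt
  have d2 : ∀ f : ℝ → ℝ, ContDiffOn ℝ (⊤ : ℕ∞) f (Ioo lo hi) →
      ∀ t ∈ Ioo lo hi, HasDerivAt (deriv f) (deriv (deriv f) t) t := by
    intro f hf t ht
    exact d1 (deriv f) (hf.deriv_of_isOpen isOpen_Ioo (by simp)) t ht
  have dr := d1 r hr
  have dc := d1 c hc
  have dX : ∀ t ∈ Ioo lo hi, HasDerivAt (deriv x) ((A₁ * t + A₀) * r t ^ 2) t :=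
    fun t ht => hx'' t ht ▸ d2 x hx t ht
  have dY : ∀ t ∈ Ioo lo hi, HasDerivAt (deriv y) ((B₁ * t + B₀) * r t ^ 2) t :=
    fun t ht => hy'' t ht ▸ d2 y hy t ht
  have dS : ∀ t ∈ Ioo lo hi, HasDerivAt (deriv r) (r t + c t * r t ^ 2) t :=
    fun t ht => hr'' t ht ▸ d2 r hr t ht
  have dD : ∀ t ∈ Ioo lo hi, HasDerivAt (deriv c) (c t) t :=
    fun t ht => by have := d2 c hc t ht; rwa [hc'' t ht] at this
  have da : ∀ t, HasDerivAt (fun t => A₁ * t + A₀) A₁ t := fun t => by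
    simpa using ((hasDerivAt_id t).const_mul A₁).add_const A₀
  have db : ∀ t, HasDerivAt (fun t => B₁ * t + B₀) B₁ t := fun t => by
    simpa using ((hasDerivAt_id t).const_mul B₁).add_const B₀
  -- first consequence
  have h1 : ∀ t ∈ Ioo lo hi, (A₁ * t + A₀) * deriv x t + (B₁ * t + B₀) * deriv y t
      + c t * deriv r t = 0 := by
    have := bh_deriv_zero lo hi
      (fun t => deriv x t ^ 2 + deriv y t ^ 2 + deriv r t ^ 2 - r t ^ 2) _
      (fun t ht => by linarith [harc t ht])
      (fun t ht => (((((dX t ht).fun_pow 2).fun_add ((dY t ht).fun_pow 2)).fun_add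
        ((dS t ht).fun_pow 2)).fun_sub ((dr t ht).fun_pow 2)))
    intro t ht
    have h := this t ht
    have hp := hrpos t ht
    have : (2 * r t ^ 2) * ((A₁ * t + A₀) * deriv x t + (B₁ * t + B₀) * deriv y t
      + c t * deriv r t) = 0 := by
      rw [← h]; push_cast; ring
    exact (mul_eq_zero.mp this).resolve_left (by positivity)
  have h2 : ∀ t ∈ Ioo lo hi, A₁ * deriv x t + B₁ * deriv y t + deriv c t * deriv r t
      + ((A₁ * t + A₀) ^ 2 + (B₁ * t + B₀) ^ 2 + c t ^ 2) * r t ^ 2 + c t * r t = 0 := by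
    have := bh_deriv_zero lo hi _ _ h1
      (fun t ht => (((da t).fun_mul (dX t ht)).fun_add ((db t).fun_mul (dY t ht))).fun_add
        ((dc t ht).fun_mul (dS t ht)))
    intro t ht
    linear_combination this t ht
  have h3 : ∀ t ∈ Ioo lo hi, 2 * c t * deriv r t + 2 * deriv c t * r t
      + 3 * (A₁ * (A₁ * t + A₀) + B₁ * (B₁ * t + B₀) + c t * deriv c t) * r t ^ 2
      + 2 * ((A₁ * t + A₀) ^ 2 + (B₁ * t + B₀) ^ 2 + c t ^ 2) * r t * deriv r t = 0 := by
    have := bh_deriv_zero lo hi _ _ h2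
      (fun t ht => (((((dX t ht).const_mul A₁).fun_add ((dY t ht).const_mul B₁)).fun_add
        ((dD t ht).fun_mul (dS t ht))).fun_add
        (((((da t).fun_pow 2).fun_add ((db t).fun_pow 2)).fun_add ((dc t ht).fun_pow 2)).fun_mul
          ((dr t ht).fun_pow 2))).fun_add ((dc t ht).fun_mul (dr t ht)))
    intro t ht
    have h := this t ht
    push_cast at h
    linear_combination h
  have h4 : ∀ t ∈ Ioo lo hi, 4 * deriv c t * deriv r t + 2 * c t * (r t + c t * r t ^ 2)
      + 2 * c t * r t
      + 3 * (A₁ ^ 2 + B₁ ^ 2 + deriv c t ^ 2 + c t ^ 2) * r t ^ 2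
      + 10 * (A₁ * (A₁ * t + A₀) + B₁ * (B₁ * t + B₀) + c t * deriv c t) * r t * deriv r t
      + 2 * ((A₁ * t + A₀) ^ 2 + (B₁ * t + B₀) ^ 2 + c t ^ 2) * deriv r t ^ 2
      + 2 * ((A₁ * t + A₀) ^ 2 + (B₁ * t + B₀) ^ 2 + c t ^ 2) * r t * (r t + c t * r t ^ 2)
      = 0 := by
    have := bh_deriv_zero lo hi _ _ h3
      (fun t ht => (((((dc t ht).const_mul 2).fun_mul (dS t ht)).fun_add
        (((dD t ht).const_mul 2).fun_mul (dr t ht))).fun_add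
        ((((((da t).const_mul A₁).fun_add ((db t).const_mul B₁)).fun_add
          ((dc t ht).fun_mul (dD t ht))).const_mul 3).fun_mul ((dr t ht).fun_pow 2))).fun_add
        (((((((da t).fun_pow 2).fun_add ((db t).fun_pow 2)).fun_add
          ((dc t ht).fun_pow 2)).const_mul 2).fun_mul (dr t ht)).fun_mul (dS t ht)))
    intro t ht
    have h := this t ht
    push_cast at h
    linear_combination h
  by_cases hA : A₁ = 0 ∧ A₀ = 0 ∧ B₁ = 0 ∧ B₀ = 0
  · refine ⟨hA.1, hA.2.1, hA.2.2.1, hA.2.2.2, fun t ht => ?_⟩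
    obtain ⟨rfl, rfl, rfl, rfl⟩ := hA
    refine bh_point0 (c t) (deriv c t) (r t) (deriv r t) (hrpos t ht) ?_ ?_ ?_ ?_
    · linear_combination h1 t ht
    · linear_combination h2 t ht
    · linear_combination h3 t ht
    · linear_combination h4 t ht
  · exfalso
    have hexp : ∀ t, Real.exp t * Real.exp (-t) = 1 := fun t => by
      rw [← Real.exp_add]; simp
    have de : ∀ t, HasDerivAt (fun t => Real.exp (-t)) (-Real.exp (-t)) t := fun t => by
      simpa using (hasDerivAt_neg t).exp
    obtain ⟨α, hα⟩ := bh_const lo hi (fun t => (c t + deriv c t) * Real.exp (-t))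
      (fun t ht => by
        have := ((dc t ht).fun_add (dD t ht)).fun_mul (de t)
        refine this.congr_deriv ?_
        ring)
    obtain ⟨β, hβ⟩ := bh_const lo hi (fun t => (c t - deriv c t) * Real.exp t)
      (fun t ht => by
        have := ((dc t ht).fun_sub (dD t ht)).fun_mul (Real.hasDerivAt_exp t)
        refine this.congr_deriv ?_
        ring)
    refine bh_main_alg lo hi hlt (A₁ ^ 2 + B₁ ^ 2) (A₁ * A₀ + B₁ * B₀) (A₀ ^ 2 + B₀ ^ 2)
      (α / 2) (β / 2) ?_ ?_ (by positivity) ?_ ?_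
    · intro t
      have : (A₁ ^ 2 + B₁ ^ 2) * t ^ 2 + 2 * (A₁ * A₀ + B₁ * B₀) * t + (A₀ ^ 2 + B₀ ^ 2)
        = (A₁ * t + A₀) ^ 2 + (B₁ * t + B₀) ^ 2 := by ring
      rw [this]; positivity
    · intro h
      have k1 : A₁ = 0 := by nlinarith [sq_nonneg A₁, sq_nonneg B₁]
      have k2 : B₁ = 0 := by nlinarith [sq_nonneg A₁, sq_nonneg B₁]
      refine ⟨by rw [k1, k2]; ring, fun h' => hA ⟨k1, ?_, k2, ?_⟩⟩
      · nlinarith [sq_nonneg A₀, sq_nonneg B₀]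
      · nlinarith [sq_nonneg A₀, sq_nonneg B₀]
    · nlinarith [sq_nonneg (A₁ * B₀ - A₀ * B₁)]
    · intro t ht
      refine ⟨r t, hrpos t ht, ?_⟩
      have e1 : α / 2 * Real.exp t + β / 2 * Real.exp (-t) = c t := by
        rw [← hα t ht, ← hβ t ht]
        linear_combination c t * hexp t
      have e2 : α / 2 * Real.exp t - β / 2 * Real.exp (-t) = deriv c t := by
        rw [← hα t ht, ← hβ t ht]
        linear_combination deriv c t * hexp t
      have e3 : (A₁ ^ 2 + B₁ ^ 2) * t ^ 2 + 2 * (A₁ * A₀ + B₁ * B₀) * t + (A₀ ^ 2 + B₀ ^ 2)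
        = (A₁ * t + A₀) ^ 2 + (B₁ * t + B₀) ^ 2 := by ring
      have e4 : (A₁ ^ 2 + B₁ ^ 2) * t + (A₁ * A₀ + B₁ * B₀)
        = A₁ * (A₁ * t + A₀) + B₁ * (B₁ * t + B₀) := by ring
      rw [e1, e2, e3, e4]
      exact bh_point _ _ _ _ _ _ _ _ _ _ (hrpos t ht) (harc t ht) (h1 t ht) (h2 t ht)
        (h3 t ht) (h4 t ht)
end

section
/- Let I ⊆ ℝ be an open interval, let u = (x, y) : I → ℝ² and r : I → ℝ be smooth with r > 0 on I, and let q(τ) = Pτ + Q where P, Q ∈ ℝ² satisfy det(P, Q) ≠ 0 (i.e., P and Q are linearly independent). Suppose u''(τ) = r(τ)²·q(τ) and u'(τ)·q(τ) = 0 (Euclidean inner product) for all τ ∈ I. Then the function τ ↦ r(τ)²·‖q(τ)‖³ is constant on I, where ‖·‖ is the Euclidean norm on ℝ². -/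
open Set RealInnerProductSpace

theorem alg_aux (a b p0 p1 q0 q1 t R c : ℝ) (hD : p0 * q1 - p1 * q0 ≠ 0)
    (h1 : a * p0 + b * p1 +
      R * ((t * p0 + q0) * (t * p0 + q0) + (t * p1 + q1) * (t * p1 + q1)) = 0)
    (h2 : a * (t * p0 + q0) + b * (t * p1 + q1) = 0)
    (h3 : a * a + b * b = c) :
    (p0 * q1 - p1 * q0) ^ 2 * c =
      R ^ 2 * ((t * p0 + q0) * (t * p0 + q0) + (t * p1 + q1) * (t * p1 + q1)) ^ 3 := by
  obtain ⟨x, hx⟩ : ∃ x, x = t * p0 + q0 := ⟨_, rfl⟩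
  obtain ⟨y, hy⟩ : ∃ y, y = t * p1 + q1 := ⟨_, rfl⟩
  have hDe : p0 * q1 - p1 * q0 = p0 * y - p1 * x := by rw [hx, hy]; ring
  rw [hDe] at hD ⊢
  rw [← hx, ← hy] at h1 h2 ⊢
  have hN : x * x + y * y ≠ 0 := by
    intro h
    have hx0 : x = 0 := by nlinarith [mul_self_nonneg x, mul_self_nonneg y]
    have hy0 : y = 0 := by nlinarith [mul_self_nonneg x, mul_self_nonneg y]
    apply hD
    rw [hx0, hy0]; ring
  have hs : R * (x * x + y * y) = -(a * p0 + b * p1) := by linarith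
  have hsN : (a * p0 + b * p1) * (x * x + y * y) = (a * y - b * x) * (p0 * y - p1 * x) := by
    linear_combination (p0 * x + p1 * y) * h2
  have hw : (a * y - b * x) ^ 2 = c * (x * x + y * y) := by
    rw [← h3]
    linear_combination (-(a * x + b * y)) * h2
  apply mul_left_cancel₀ hN
  calc (x * x + y * y) * ((p0 * y - p1 * x) ^ 2 * c)
      = (c * (x * x + y * y)) * (p0 * y - p1 * x) ^ 2 := by ring
    _ = ((a * y - b * x) * (p0 * y - p1 * x)) ^ 2 := by rw [← hw]; ring
    _ = (-(a * p0 + b * p1)) ^ 2 * (x * x + y * y) ^ 2 := by rw [← hsN]; ring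
    _ = _ := by rw [← hs]; ring

/-- Key step in excluding Case (III): if `u'' = r²·q` and `u' ⟂ q` with
`q(τ) = τP + Q`, `det(P,Q) ≠ 0`, then `r²‖q‖³` is constant. -/
theorem case_III_r_sq_norm_q_cubed_const
    (lo hi : ℝ) (u : ℝ → EuclideanSpace ℝ (Fin 2)) (r : ℝ → ℝ)
    (P Q : EuclideanSpace ℝ (Fin 2))
    (hu : ContDiffOn ℝ (⊤ : ℕ∞) u (Ioo lo hi))
    (hr : ContDiffOn ℝ (⊤ : ℕ∞) r (Ioo lo hi))
    (hrpos : ∀ τ ∈ Ioo lo hi, 0 < r τ)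
    (hdet : P 0 * Q 1 - P 1 * Q 0 ≠ 0)
    (hu'' : ∀ τ ∈ Ioo lo hi, deriv (deriv u) τ = r τ ^ 2 • (τ • P + Q))
    (horth : ∀ τ ∈ Ioo lo hi, ⟪deriv u τ, τ • P + Q⟫ = 0) :
    ∃ k : ℝ, ∀ τ ∈ Ioo lo hi, r τ ^ 2 * ‖τ • P + Q‖ ^ 3 = k := by
  have hdv : ∀ τ ∈ Ioo lo hi, HasDerivAt (deriv u) (r τ ^ 2 • (τ • P + Q)) τ := by
    intro τ hτ
    have h1 : ContDiffOn ℝ 1 (deriv u) (Ioo lo hi) :=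
      hu.deriv_of_isOpen isOpen_Ioo (by
        have : ((2 : ℕ∞) : WithTop ℕ∞) ≤ ((⊤ : ℕ∞) : WithTop ℕ∞) := WithTop.coe_le_coe.2 le_top
        convert this using 1
        exact one_add_one_eq_two)
    have h2 : DifferentiableAt ℝ (deriv u) τ :=
      (h1.differentiableOn (by norm_num)).differentiableAt (isOpen_Ioo.mem_nhds hτ)
    rw [← hu'' τ hτ]
    exact h2.hasDerivAt
  have hn : ∀ τ ∈ Ioo lo hi, HasDerivAt (fun t => ⟪deriv u t, deriv u t⟫) 0 τ := by
    intro τ hτ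
    have h := (hdv τ hτ).inner ℝ (hdv τ hτ)
    have e : ⟪deriv u τ, r τ ^ 2 • (τ • P + Q)⟫ + ⟪r τ ^ 2 • (τ • P + Q), deriv u τ⟫ = 0 := by
      rw [real_inner_comm (deriv u τ) (r τ ^ 2 • (τ • P + Q)), real_inner_smul_right, horth τ hτ]
      simp
    rw [e] at h
    exact h
  obtain ⟨c, hc⟩ : ∃ c, ∀ τ ∈ Ioo lo hi, ⟪deriv u τ, deriv u τ⟫ = c :=
    isOpen_Ioo.exists_is_const_of_deriv_eq_zero isPreconnected_Ioo
      (fun τ hτ => (hn τ hτ).differentiableAt.differentiableWithinAt)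
      (fun τ hτ => (hn τ hτ).deriv)
  have hq : ∀ τ : ℝ, HasDerivAt (fun t : ℝ => t • P + Q) P τ := by
    intro τ
    simpa using ((hasDerivAt_id τ).smul_const P).add_const Q
  refine ⟨Real.sqrt ((P 0 * Q 1 - P 1 * Q 0) ^ 2 * c), fun τ hτ => ?_⟩
  have h1 : ⟪deriv u τ, P⟫ + r τ ^ 2 * ⟪τ • P + Q, τ • P + Q⟫ = 0 := by
    have h := (hdv τ hτ).inner ℝ (hq τ)
    have h' : HasDerivAt (fun t => ⟪deriv u t, t • P + Q⟫) 0 τ := by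
      refine (hasDerivAt_const τ (0:ℝ)).congr_of_eventuallyEq ?_
      filter_upwards [isOpen_Ioo.mem_nhds hτ] with t ht using horth t ht
    have := h.unique h'
    rwa [real_inner_smul_left] at this
  have h2 := horth τ hτ
  have h3 := hc τ hτ
  have hN : ‖τ • P + Q‖ ^ 2 = ⟪τ • P + Q, τ • P + Q⟫ := (real_inner_self_eq_norm_sq _).symm
  symm
  have key : (P 0 * Q 1 - P 1 * Q 0) ^ 2 * c = (r τ ^ 2 * ‖τ • P + Q‖ ^ 3) ^ 2 := by
    have e6 : (r τ ^ 2 * ‖τ • P + Q‖ ^ 3) ^ 2 = (r τ ^ 2) ^ 2 * (‖τ • P + Q‖ ^ 2) ^ 3 := by ring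
    rw [e6, hN]
    simp only [PiLp.inner_apply, Fin.sum_univ_two, PiLp.add_apply, PiLp.smul_apply, smul_eq_mul,
      RCLike.inner_apply, conj_trivial] at h1 h2 h3 ⊢
    exact alg_aux (deriv u τ 0) (deriv u τ 1) (P 0) (P 1) (Q 0) (Q 1) τ (r τ ^ 2) c
      hdet (by linarith) (by linarith) (by linarith)
  rw [key, Real.sqrt_sq (by positivity)]
end

section
/- Let I ⊆ ℝ be an open interval, α ∈ ℝ with α ≠ 0, and let x, y, r, c : I → ℝ be smooth with r > 0 on I, satisfying on I: x'' = α·r², y'' = 0, r'' = r + c·r², c'' = c, and x'² + y'² + r'² = r². Then the function G := c'·r' + c·r + (α² + c²)·r² vanishes identically on I. -/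
open Set

theorem aux_deriv_eq {lo hi : ℝ} {f g : ℝ → ℝ} (h : ∀ t ∈ Ioo lo hi, f t = g t)
    {t a b : ℝ} (ht : t ∈ Ioo lo hi) (hf : HasDerivAt f a t) (hg : HasDerivAt g b t) : a = b := by
  have e : f =ᶠ[nhds t] g := by
    filter_upwards [isOpen_Ioo.mem_nhds ht] with s hs using h s hs
  exact (hf.congr_of_eventuallyEq e.symm).unique hg

theorem aux_smooth {lo hi : ℝ} {f : ℝ → ℝ} (hf : ContDiffOn ℝ (⊤ : ℕ∞) f (Ioo lo hi))
    {t : ℝ} (ht : t ∈ Ioo lo hi) :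
    HasDerivAt f (deriv f t) t ∧ HasDerivAt (deriv f) (deriv (deriv f) t) t := by
  have ho := isOpen_Ioo.mem_nhds ht
  have h2 : ContDiffOn ℝ 1 (deriv f) (Ioo lo hi) :=
    hf.deriv_of_isOpen isOpen_Ioo (by
      have : ((2 : ℕ∞) : WithTop ℕ∞) ≤ ((⊤ : ℕ∞) : WithTop ℕ∞) := WithTop.coe_le_coe.mpr le_top
      rw [one_add_one_eq_two]; exact this)
  exact ⟨((hf.differentiableOn (by simp)).differentiableAt ho).hasDerivAt,
    ((h2.differentiableOn (by simp)).differentiableAt ho).hasDerivAt⟩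

/-- Main tool for excluding Case (V): the function
`G = c'·r' + c·r + (α² + c²)·r²` vanishes identically. -/
theorem case_V_G_vanishes
    (lo hi : ℝ) (α : ℝ) (hα : α ≠ 0) (x y r c : ℝ → ℝ)
    (hx : ContDiffOn ℝ (⊤ : ℕ∞) x (Ioo lo hi))
    (hy : ContDiffOn ℝ (⊤ : ℕ∞) y (Ioo lo hi))
    (hr : ContDiffOn ℝ (⊤ : ℕ∞) r (Ioo lo hi))
    (hc : ContDiffOn ℝ (⊤ : ℕ∞) c (Ioo lo hi))
    (hrpos : ∀ τ ∈ Ioo lo hi, 0 < r τ)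
    (hx'' : ∀ τ ∈ Ioo lo hi, deriv (deriv x) τ = α * r τ ^ 2)
    (hy'' : ∀ τ ∈ Ioo lo hi, deriv (deriv y) τ = 0)
    (hr'' : ∀ τ ∈ Ioo lo hi, deriv (deriv r) τ = r τ + c τ * r τ ^ 2)
    (hc'' : ∀ τ ∈ Ioo lo hi, deriv (deriv c) τ = c τ)
    (harc : ∀ τ ∈ Ioo lo hi,
      deriv x τ ^ 2 + deriv y τ ^ 2 + deriv r τ ^ 2 = r τ ^ 2) :
    ∀ τ ∈ Ioo lo hi,
      deriv c τ * deriv r τ + c τ * r τ + (α ^ 2 + c τ ^ 2) * r τ ^ 2 = 0 := by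
  have key : ∀ t ∈ Ioo lo hi, α * deriv x t + c t * deriv r t = 0 := by
    intro t ht
    obtain ⟨_, x2⟩ := aux_smooth hx ht
    obtain ⟨_, y2⟩ := aux_smooth hy ht
    obtain ⟨r1, r2⟩ := aux_smooth hr ht
    have h := aux_deriv_eq harc ht (((x2.fun_pow 2).fun_add (y2.fun_pow 2)).fun_add (r2.fun_pow 2))
      (r1.fun_pow 2)
    rw [hx'' t ht, hy'' t ht, hr'' t ht] at h
    have hp := hrpos t ht
    have h3 : r t ^ 2 * (α * deriv x t + c t * deriv r t) = 0 := by
      norm_num at h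
      linarith
    exact (mul_eq_zero.mp h3).resolve_left (by positivity)
  intro t ht
  obtain ⟨_, x2⟩ := aux_smooth hx ht
  obtain ⟨c1, _⟩ := aux_smooth hc ht
  obtain ⟨_, r2⟩ := aux_smooth hr ht
  have h := aux_deriv_eq key ht ((x2.const_mul α).fun_add (c1.fun_mul r2)) (hasDerivAt_const t 0)
  rw [hx'' t ht, hr'' t ht] at h
  linarith
end

section
/- Let r, c be smooth real-valued functions on an open interval containing 0 satisfying r'' = r + c·r² and c'' = c. Write r₀ = r(0), r₁ = r'(0), c₀ = c(0), c₁ = c'(0). Then: r''(0) = r₀ + c₀r₀²; r'''(0) = r₁ + 2c₀r₀r₁ + c₁r₀²; r⁽⁴⁾(0) = r₀ + 4c₀r₀² + 2c₀²r₀³ + 2c₀r₁² + 4c₁r₀r₁; r⁽⁵⁾(0) = r₁ + 16c₀r₀r₁ + 10c₀²r₀²r₁ + 8c₀c₁r₀³ + 8c₁r₀² + 6c₁r₁²; r⁽⁶⁾(0) = r₀ + 25c₀r₀² + 34c₀²r₀³ + 10c₀³r₀⁴ + 22c₀r₁² + 20c₀²r₀r₁² + 44c₁r₀r₁ + 56c₀c₁r₀²r₁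 + 8c₁²r₀³; and r⁽⁷⁾(0) = r₁ + 138c₀r₀r₁ + 242c₀²r₀²r₁ + 80c₀³r₀³r₁ + 69c₁r₀² + 184c₀c₁r₀³ + 86c₀²c₁r₀⁴ + 66c₁r₁² + 152c₀c₁r₀r₁² + 80c₁²r₀²r₁ + 20c₀²r₁³. -/
open Set

/-- Claim 1 of the paper: the Taylor coefficients at `0` of a solution of
`r'' = r + c·r²`, `c'' = c` in terms of `r₀ = r(0)`, `r₁ = r'(0)`,
`c₀ = c(0)`, `c₁ = c'(0)`. -/
theorem taylor_coefficients_radial_equation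
    (lo hi : ℝ) (h0 : (0 : ℝ) ∈ Ioo lo hi) (r c : ℝ → ℝ)
    (hr : ContDiffOn ℝ (⊤ : ℕ∞) r (Ioo lo hi))
    (hc : ContDiffOn ℝ (⊤ : ℕ∞) c (Ioo lo hi))
    (hr'' : ∀ s ∈ Ioo lo hi, iteratedDeriv 2 r s = r s + c s * r s ^ 2)
    (hc'' : ∀ s ∈ Ioo lo hi, iteratedDeriv 2 c s = c s) :
    let r₀ := r 0; let r₁ := deriv r 0; let c₀ := c 0; let c₁ := deriv c 0
    iteratedDeriv 2 r 0 = r₀ + c₀ * r₀ ^ 2 ∧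
    iteratedDeriv 3 r 0 = r₁ + 2 * c₀ * r₀ * r₁ + c₁ * r₀ ^ 2 ∧
    iteratedDeriv 4 r 0
      = r₀ + 4 * c₀ * r₀ ^ 2 + 2 * c₀ ^ 2 * r₀ ^ 3 + 2 * c₀ * r₁ ^ 2
        + 4 * c₁ * r₀ * r₁ ∧
    iteratedDeriv 5 r 0
      = r₁ + 16 * c₀ * r₀ * r₁ + 10 * c₀ ^ 2 * r₀ ^ 2 * r₁
        + 8 * c₀ * c₁ * r₀ ^ 3 + 8 * c₁ * r₀ ^ 2 + 6 * c₁ * r₁ ^ 2 ∧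
    iteratedDeriv 6 r 0
      = r₀ + 25 * c₀ * r₀ ^ 2 + 34 * c₀ ^ 2 * r₀ ^ 3 + 10 * c₀ ^ 3 * r₀ ^ 4
        + 22 * c₀ * r₁ ^ 2 + 20 * c₀ ^ 2 * r₀ * r₁ ^ 2 + 44 * c₁ * r₀ * r₁
        + 56 * c₀ * c₁ * r₀ ^ 2 * r₁ + 8 * c₁ ^ 2 * r₀ ^ 3 ∧
    iteratedDeriv 7 r 0
      = r₁ + 138 * c₀ * r₀ * r₁ + 242 * c₀ ^ 2 * r₀ ^ 2 * r₁
        + 80 * c₀ ^ 3 * r₀ ^ 3 * r₁ + 69 * c₁ * r₀ ^ 2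
        + 184 * c₀ * c₁ * r₀ ^ 3 + 86 * c₀ ^ 2 * c₁ * r₀ ^ 4
        + 66 * c₁ * r₁ ^ 2 + 152 * c₀ * c₁ * r₀ * r₁ ^ 2
        + 80 * c₁ ^ 2 * r₀ ^ 2 * r₁ + 20 * c₀ ^ 2 * r₁ ^ 3 := by
  have cg : ∀ (f g : ℝ → ℝ) (a b s : ℝ), HasDerivAt f a s → (∀ x, g x = f x) → b = a →
      HasDerivAt g b s := by
    intro f g a b s h h1 h2
    rw [h2, show g = f from funext h1]
    exact h
  have step : ∀ (n : ℕ) (f g : ℝ → ℝ), (∀ s ∈ Ioo lo hi, iteratedDeriv n r s = f s) →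
      (∀ s ∈ Ioo lo hi, HasDerivAt f (g s) s) →
      ∀ s ∈ Ioo lo hi, iteratedDeriv (n + 1) r s = g s := by
    intro n f g h1 h2 s hs
    rw [iteratedDeriv_succ]
    have : iteratedDeriv n r =ᶠ[nhds s] f := by
      filter_upwards [isOpen_Ioo.mem_nhds hs] with x hx using h1 x hx
    rw [this.deriv_eq, (h2 s hs).deriv]
  have base : ∀ f : ℝ → ℝ, ContDiffOn ℝ (⊤ : ℕ∞) f (Ioo lo hi) → ∀ s ∈ Ioo lo hi,
      HasDerivAt f (deriv f s) s ∧ HasDerivAt (deriv f) (iteratedDeriv 2 f s) s := by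
    intro f hf s hs
    refine ⟨((hf.differentiableOn (by simp)).differentiableAt
      (isOpen_Ioo.mem_nhds hs)).hasDerivAt, ?_⟩
    have h1 : ContDiffOn ℝ 1 (deriv f) (Ioo lo hi) :=
      hf.deriv_of_isOpen isOpen_Ioo (by
        have h : ((2 : ℕ∞) : WithTop ℕ∞) ≤ ((⊤ : ℕ∞) : WithTop ℕ∞) := WithTop.coe_le_coe.2 le_top
        rwa [show (1 + 1 : WithTop ℕ∞) = ((2 : ℕ∞) : WithTop ℕ∞) from one_add_one_eq_two])
    have h2 := ((h1.differentiableOn (by simp)).differentiableAt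
      (isOpen_Ioo.mem_nhds hs)).hasDerivAt
    rwa [iteratedDeriv_succ, iteratedDeriv_one]
  have R0 := fun s hs => (base r hr s hs).1
  have C0 := fun s hs => (base c hc s hs).1
  have R1 : ∀ s ∈ Ioo lo hi, HasDerivAt (deriv r) (r s + c s * r s ^ 2) s :=
    fun s hs => hr'' s hs ▸ (base r hr s hs).2
  have C1 : ∀ s ∈ Ioo lo hi, HasDerivAt (deriv c) (c s) s :=
    fun s hs => by
      have h := (base c hc s hs).2
      rwa [hc'' s hs] at h
  -- derivative of a monomial
  have mono : ∀ (k : ℝ) (a b p q : ℕ), ∀ s ∈ Ioo lo hi,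
      HasDerivAt (fun s => k * r s ^ a * deriv r s ^ b * c s ^ p * deriv c s ^ q)
        (k * (a * r s ^ (a - 1) * deriv r s) * deriv r s ^ b * c s ^ p * deriv c s ^ q
        + k * r s ^ a * (b * deriv r s ^ (b - 1) * (r s + c s * r s ^ 2)) * c s ^ p * deriv c s ^ q
        + k * r s ^ a * deriv r s ^ b * (p * c s ^ (p - 1) * deriv c s) * deriv c s ^ q
        + k * r s ^ a * deriv r s ^ b * c s ^ p * (q * deriv c s ^ (q - 1) * c s)) s := by
    intro k a b p q s hs
    have h := (((((R0 s hs).pow a).const_mul k).mul ((R1 s hs).pow b)).mul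
      ((C0 s hs).pow p)).mul ((C1 s hs).pow q)
    refine cg _ _ _ _ s h (fun x => rfl) ?_
    simp only [Pi.mul_apply, Pi.pow_apply]
    ring
  have H3 : ∀ s ∈ Ioo lo hi, iteratedDeriv 3 r s =
      deriv r s + 2 * c s * r s * deriv r s + deriv c s * r s ^ 2 := by
    refine step 2 (fun s => r s + c s * r s ^ 2)
      (fun s => deriv r s + 2 * c s * r s * deriv r s + deriv c s * r s ^ 2) hr'' ?_
    intro s hs
    have h := ((mono 1 1 0 0 0 s hs).add
      (mono 1 2 0 1 0 s hs))
    refine cg _ _ _ _ s h ?_ ?_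
    · intro x
      simp only [Pi.add_apply]
      ring
    · norm_num
      ring
  have H4 : ∀ s ∈ Ioo lo hi, iteratedDeriv 4 r s =
      r s + 4 * c s * r s ^ 2 + 2 * c s ^ 2 * r s ^ 3 + 2 * c s * deriv r s ^ 2 + 4 * deriv c s * r s * deriv r s := by
    refine step 3 (fun s => deriv r s + 2 * c s * r s * deriv r s + deriv c s * r s ^ 2)
      (fun s => r s + 4 * c s * r s ^ 2 + 2 * c s ^ 2 * r s ^ 3 + 2 * c s * deriv r s ^ 2 + 4 * deriv c s * r s * deriv r s) H3 ?_
    intro s hs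
    have h := (((mono 1 0 1 0 0 s hs).add
      (mono 2 1 1 1 0 s hs)).add
      (mono 1 2 0 0 1 s hs))
    refine cg _ _ _ _ s h ?_ ?_
    · intro x
      simp only [Pi.add_apply]
      ring
    · norm_num
      ring
  have H5 : ∀ s ∈ Ioo lo hi, iteratedDeriv 5 r s =
      deriv r s + 16 * c s * r s * deriv r s + 10 * c s ^ 2 * r s ^ 2 * deriv r s + 8 * c s * deriv c s * r s ^ 3 + 8 * deriv c s * r s ^ 2 + 6 * deriv c s * deriv r s ^ 2 := by
    refine step 4 (fun s => r s + 4 * c s * r s ^ 2 + 2 * c s ^ 2 * r s ^ 3 + 2 * c s * deriv r s ^ 2 + 4 * deriv c s * r s * deriv r s)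
      (fun s => deriv r s + 16 * c s * r s * deriv r s + 10 * c s ^ 2 * r s ^ 2 * deriv r s + 8 * c s * deriv c s * r s ^ 3 + 8 * deriv c s * r s ^ 2 + 6 * deriv c s * deriv r s ^ 2) H4 ?_
    intro s hs
    have h := (((((mono 1 1 0 0 0 s hs).add
      (mono 4 2 0 1 0 s hs)).add
      (mono 2 3 0 2 0 s hs)).add
      (mono 2 0 2 1 0 s hs)).add
      (mono 4 1 1 0 1 s hs))
    refine cg _ _ _ _ s h ?_ ?_
    · intro x
      simp only [Pi.add_apply]
      ring
    · norm_num
      ring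
  have H6 : ∀ s ∈ Ioo lo hi, iteratedDeriv 6 r s =
      r s + 25 * c s * r s ^ 2 + 34 * c s ^ 2 * r s ^ 3 + 10 * c s ^ 3 * r s ^ 4 + 22 * c s * deriv r s ^ 2 + 20 * c s ^ 2 * r s * deriv r s ^ 2 + 44 * deriv c s * r s * deriv r s + 56 * c s * deriv c s * r s ^ 2 * deriv r s + 8 * deriv c s ^ 2 * r s ^ 3 := by
    refine step 5 (fun s => deriv r s + 16 * c s * r s * deriv r s + 10 * c s ^ 2 * r s ^ 2 * deriv r s + 8 * c s * deriv c s * r s ^ 3 + 8 * deriv c s * r s ^ 2 + 6 * deriv c s * deriv r s ^ 2)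
      (fun s => r s + 25 * c s * r s ^ 2 + 34 * c s ^ 2 * r s ^ 3 + 10 * c s ^ 3 * r s ^ 4 + 22 * c s * deriv r s ^ 2 + 20 * c s ^ 2 * r s * deriv r s ^ 2 + 44 * deriv c s * r s * deriv r s + 56 * c s * deriv c s * r s ^ 2 * deriv r s + 8 * deriv c s ^ 2 * r s ^ 3) H5 ?_
    intro s hs
    have h := ((((((mono 1 0 1 0 0 s hs).add
      (mono 16 1 1 1 0 s hs)).add
      (mono 10 2 1 2 0 s hs)).add
      (mono 8 3 0 1 1 s hs)).add
      (mono 8 2 0 0 1 s hs)).add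
      (mono 6 0 2 0 1 s hs))
    refine cg _ _ _ _ s h ?_ ?_
    · intro x
      simp only [Pi.add_apply]
      ring
    · norm_num
      ring
  have H7 : ∀ s ∈ Ioo lo hi, iteratedDeriv 7 r s =
      deriv r s + 138 * c s * r s * deriv r s + 242 * c s ^ 2 * r s ^ 2 * deriv r s + 80 * c s ^ 3 * r s ^ 3 * deriv r s + 69 * deriv c s * r s ^ 2 + 184 * c s * deriv c s * r s ^ 3 + 86 * c s ^ 2 * deriv c s * r s ^ 4 + 66 * deriv c s * deriv r s ^ 2 + 152 * c s * deriv c s * r s * deriv r s ^ 2 + 80 * deriv c s ^ 2 * r s ^ 2 * deriv r s + 20 * c s ^ 2 * deriv r s ^ 3 := by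
    refine step 6 (fun s => r s + 25 * c s * r s ^ 2 + 34 * c s ^ 2 * r s ^ 3 + 10 * c s ^ 3 * r s ^ 4 + 22 * c s * deriv r s ^ 2 + 20 * c s ^ 2 * r s * deriv r s ^ 2 + 44 * deriv c s * r s * deriv r s + 56 * c s * deriv c s * r s ^ 2 * deriv r s + 8 * deriv c s ^ 2 * r s ^ 3)
      (fun s => deriv r s + 138 * c s * r s * deriv r s + 242 * c s ^ 2 * r s ^ 2 * deriv r s + 80 * c s ^ 3 * r s ^ 3 * deriv r s + 69 * deriv c s * r s ^ 2 + 184 * c s * deriv c s * r s ^ 3 + 86 * c s ^ 2 * deriv c s * r s ^ 4 + 66 * deriv c s * deriv r s ^ 2 + 152 * c s * deriv c s * r s * deriv r s ^ 2 + 80 * deriv c s ^ 2 * r s ^ 2 * deriv r s + 20 * c s ^ 2 * deriv r s ^ 3) H6 ?_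
    intro s hs
    have h := (((((((((mono 1 1 0 0 0 s hs).add
      (mono 25 2 0 1 0 s hs)).add
      (mono 34 3 0 2 0 s hs)).add
      (mono 10 4 0 3 0 s hs)).add
      (mono 22 0 2 1 0 s hs)).add
      (mono 20 1 2 2 0 s hs)).add
      (mono 44 1 1 0 1 s hs)).add
      (mono 56 2 1 1 1 s hs)).add
      (mono 8 3 0 0 2 s hs))
    refine cg _ _ _ _ s h ?_ ?_
    · intro x
      simp only [Pi.add_apply]
      ring
    · norm_num
      ring
  exact ⟨hr'' 0 h0, H3 0 h0, H4 0 h0, H5 0 h0, H6 0 h0, H7 0 h0⟩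
end

section
/- Let A, B, u, p, t be real numbers satisfying E₀ = E₂ = E₃ = E₄ = E₅ = E₆ = 0, where E₀ := B(B + pu + t + t²)² + Ap²(B + t²) − AB; E₂ := 2Bp + 2pt² + 2pt + 3tu + 2u; E₃ := 3A + 2Bp² + 2Bt + 2B + 2p²t² + 10ptu + 4pu + 2t³ + 7t² + 4t + 3u²; E₄ := 8Ap + 5Bpt + 4Bp + Bu + 7p²tu + 5pt³ + 14pt² + 4pt + 8pu² + 8t²u + 17tu + 4u; E₅ := 15Ap² + 15At + 15A + 10Bp²t + 4Bp² + 8Bpu + 5Bt² + 10Bt + 4B + 10p²t³ + 21p²t² + 15p²u² + 53pt²u + 92ptu + 8pu + 5t⁴ + 27t³ + 35t² + 24tu² + 8t + 25u²; E₆ := 120Apt + 96Ap + 24Au + 10Bp³t + 26Bp²u + 40Bpt² + 66Bpt + 16Bp + 18Btu + 18Bu + 10p³t³ + 136p²t²u + 164p²tu + 40pt⁴ + 196pt³ + 204pt² + 208ptu² + 16pt + 172pu² + 73t³u + 274t²u + 220tu + 24u³ + 16u. Then p·t⁴ = 0; in particular p = 0 or t = 0. -/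
/-- The reduced system in `q = p²`, `z = u/(pt)`, `t` forces `t = 0`. -/
theorem reduced_aux (q z t : ℝ)
    (h4 : -70*q*z*t - 32*q*z + 32*q - 9*z^2*t^2 - 6*z^2*t + 45*z*t^2 + 110*z*t + 32*z - 18*t - 32 =
      0)
    (h6 : -7*q*z^2*t + 34*q*z^2 - 185*q*z*t - 20*q*z + 70*q - 3*z^2*t^2 + 13*z^2*t + 10*z^2 +
      115*z*t^2 + 281*z*t + 116*z - 30*t - 18 = 0)
    (h5 : -210*q^2*z - 3*q*z^2*t + 62*q*z^2 - 65*q*z*t + 428*q*z + 122*q + 27*z^2*t + 18*z^2 +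
      120*z*t^2 + 185*z*t - 26*z - 48*t - 10 = 0)
    (h0 : 120*q^2*z^2*t + 90*q^2*z^2 - 6*q^2*z + 216*q*z^3*t^2 + 207*q*z^3*t + 42*q*z^3 +
      72*q*z^2*t^2 - 108*q*z^2*t - 66*q*z^2 - 43*q*z*t + 82*q*z + 62*q - 162*z^3*t^3 -
      324*z^3*t^2 - 207*z^3*t - 42*z^3 - 108*z^2*t^3 - 180*z^2*t^2 - 60*z^2*t - 24*z^2 +
      48*z*t^2 + 11*z*t - 76*z - 48*t - 62 = 0)
    : t = 0 := by
  have key : (724275430068396470064135871576497327367573266583474286253952512000 : ℝ) * t = 0 := by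
    linear_combination
      (-1456932363998147735369245867552902494945856823287516585279685248000*q^4*z -
        29593938643712375874687806684668331928587716723027680638493606600000*q^4 +
        5912560469541845380635863224704218125772295349235742000036773280000*q^3*z*t +
        1836728495716928287426694207599349984489506439252508634973629863325080*q^3*z +
        75050591592708914408936722533925862305251979233495765213870464880000*q^3*t +
        39617738886495235448390390691492146967923683224242826452485486609496400*q^3 +
        74315754032732581786912747700102329863904911143525025728107745280*q^2*z^3 -
        52286716441146376380072102997869688434843681879809060592666659386800*q^2*z^2*t -
        337418908800939300012680188487580286901950794990294249510736476844318*q^2*z^2 -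
        7231816574745695357336484469100442106035498660091091915423705616000*q^2*z*t^2 -
        2958124578062271355147241533226540700442581791623035289345262462188840*q^2*z*t -
        6629114267478008359175800687577161110970034614025390987433626478185224*q^2*z -
        68449131383973549793155276894452960024696614162504648626909793632000*q^2*t^2 -
        65551448927277285168838481454748455145388280069385162612672534025089400*q^2*t -
        97727102105416106213260371721640437165329799486450830238513925058455866*q^2 -
        25052532603677225280071747589383273613062619081318386392067239822800*q*z^3*t -
        11209451732251354819875276354968646660203195165041376416584475206120*q*z^3 +
        81826852723291014133949831941151716505506140222707831097719815062660*q*z^2*t^2 +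
        177206576558086103394407506912057638013992038799614864611966815081528*q*z^2*t -
        522830425855197101060051434490464024044095806744821485708942568681500*q*z^2 +
        3510947568025541027046389932830105773357820664097058254612499096000*q*z*t^3 +
        944858214571403525783767977996761395002514758261566807114638224197055*q*z*t^2 +
        8475759772954459694183989474073637129049212639714154999537564869524596*q*z*t +
        8820169591963801255816177234580658663421579362089718996038546053287744*q*z +
        26156968523613786001464926332076624893585460070280283565266458176000*q*t^3 +
        33856878380205923405132807606146665428039743890835407002284866882606800*q*t^2 +
        96045069963010384218168083978725654175987804088545446773672016064272780*q*t +
        62428361806307988601122385088978903982203539034499745346511857567874140*q +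
        18747596841114506882798672271456147649248517798470556967078369260380*z^3*t^2 +
        22475487664741274805616017317338211645220499515319052186164794701280*z^3*t +
        5592066369711923293129568084143431725370301887307805261851367710920*z^3 -
        31958861544323423886671816019562087634530034109638276739914865391920*z^2*t^3 -
        141314480339660388802547803664585125133937112053533603841389535134520*z^2*t^2 -
        720661346794837166644544196158925474435381352884033791668062600955344*z^2*t -
        501519947627605396909380942437867675154404190654673191200538368235846*z^2 -
        596925781425086253481143954326820588224972492870031004614105624000*z*t^4 -
        357489831457574326892070166585467940437579274179435123629799759110250*z*t^3 -
        4989153407740371085903300817536739481285765783604619366782120134769755*z*t^2 -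
        10143332473610077630288067943292256737332847209792317865845275564774716*z*t -
        4920372038782430466345308358676310204794365240641683547284529424395696*z -
        3407638893552007201790030711004426763372602073832388109538637312000*t^4 -
        5175639536148441448487218171139281246029854958150845378530648449638400*t^3 -
        18465498858496205286544954771037547254433164722507049931383831133636124*t^2 -
        14884734707913929637915002897140300819541332639817489578911165373413164*t -
        3827426794025809200481733685409619544694494370172642917862724698399026) * h4 +
      (13528657665697086114142997341562666024497241930526939720454220160000*q^4 -
        1569069432247567852610493945988461170941689535050754013417830118400*q^3*z -
        32541833522779965951625865342325270471037999723978218909791661312000*q^3*t -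
        18126192466489709578125629161348946298147375062642022081734966377747200*q^3 -
        877943167960070373412251490085495436900706813900451800895512381440*q^2*z^2 -
        1160219160885012359992302736430666531014096298613758610149238315470760*q^2*z*t -
        1746349410727655957659649309916578924425688698453725490880850728702816*q^2*z +
        25904735622199516189057114653868942371033254068359559281608477184000*q^2*t^2 +
        27615555628640115214761523872471673225617107334259823937337396246825600*q^2*t +
        65113732991904567862716228596838074266169510135651960964096866718018656*q^2 +
        37605562281623716084943800041015636798602485156964470850367774720*q*z^3 +
        282743534883335578068084806952305134972767226161974966423610723592176*q*z^2*t +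
        2131168763430096571782937483003618969422702587236265518765207369678032*q*z^2 +
        1707502944570962138434008063023197916896537513394179491403257057846420*q*z*t^2 -
        1833680524438247466751070582576522074254054016767603451331401395298512*q*z*t +
        9615713594043988238030946665408217017559211368530006203762968944377808*q*z -
        6815277787104014403580061422008853526745204147664776219077274624000*q*t^3 -
        10349994807646716145517866745056840086067939499947421629731714077875200*q*t^2 -
        40037274710826111349533550543652918164025563730519171354120218253226192*q*t -
        44408925498666408376606674229038097249362374366490241576315702753218368*q +
        6923352866133970222602773433067075975844772595818833675923904386920*z^3*t +
        4615568577422646815068515622044717317229848397212555783949269591280*z^3 +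
        1118096127773519577579043038127513081335345844844531881849003347385872*z^2*t +
        720781052769425602038996608767436895198338038444554290384939460437088*z^2 -
        1927651190501417851042177165572571545981380582221467953233752000*z*t^4 +
        35640547579493285707322570053662527861463356106973846158250357338510*z*t^3 +
        5995501799870334673877015236950151682075787509024854084551986045308560*z*t^2 +
        8073063797719389807596766926966575690362877533149114720546750535507024*z*t -
        1045963130001239031551853612871349852429813954399369280970332362231520*z -
        2766034677015978272854170310903034288016145250629393985802065808000*t^3 -
        4330797596575531340161112904496408475081381509020628543798643603141868*t^2 -
        10235269331713500404621962483901728355494389048177612807644019021453872*t +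
        1383088531719323754833880630054927634286555716390440726465701047616304) * h6 +
      (2386346190079279054309729073197619715786317528075182352521879017600*q^3*z -
        2053456967114736285182419239344333235861188507312124778997515560000*q^3*t +
        3000834670132919595757982432301564985763481630414134925905147625600*q^3 +
        438359387864291599245477276697272205717042824324678644647194408960*q^2*z^2 -
        3198378242529988363567660262397574173485621375632170383521826342687466*q^2*z +
        5353528027024931141559834071344657105410020119242416586168506352000*q^2*t^2 +
        2752581999012465765822546926530660862539199975468615636528094435152400*q^2*t -
        4021319977479294608251833841719726779206067750942219379700233146751114*q^2 -
        22720027211814328467986879191446947232489001448999367805430530560*q*z^3 -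
        1174937759760521054501799922187520084708548044330766325731153410182324*q*z^2 +
        7102644663386376416172487048003542698920477504778607029499096344675726*q*z*t +
        3338267986136792374611183794568743402869824660187727455636802795645192*q*z -
        4573168021366408685299039771683391130954351631664718356173369696000*q*t^3 -
        4753340293108058808252665827954432983820209176788602048502826591331800*q*t^2 -
        15078968624514622147597484290206189763806150591983601511075171503339450*q*t -
        7200411498157370176887129638153516989660544910433169841769264090572932*q -
        3804788624438301695499623704433559266224738475781355158501555031110*z^3*t -
        2536525749625534463666415802955706177483158983854236772334370020740*z^3 -
        614306517212576839489063314449393290130478053175009956450482270401930*z^2*t -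
        393031748897937881530394152113060602593962539764479657025006052496240*z^2 -
        280009889128366150362508108281705811288246904842079558168678505185715*z*t^3 -
        5337755212117639271035695617813958391071587738074768802564715025940136*z*t^2 -
        10041710908245268906425442437274289662877053757394743148721886975676608*z*t -
        3552936789424131279665002708364425686677191455945863383832496925753562*z +
        1277864585082002700671261516626660036264725777687145541076988992000*t^4 +
        1944565936961953010505159095426988630427080044732651004303535742456400*t^3 +
        12668518435471509868121411537341747937456693982398430113967625415200664*t^2 +
        23215348771018723904725580225343037030540783660402624315737715782551788*t +
        9373087112047420446396229253154593159358685692497523492292856835670514) * h5 +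
      (-60705515166589488973718577814704270622744034303646524386653552000*q^3 +
        200827549855968107462872034334980885606787613823754356711542056000*q^2*t +
        23055157552634729528903362896800505061488329356958528099139212473950*q^2 +
        3096489751363857574454697820837597077662704630980209405337822720*q*z^2 -
        2178613185047765682503004291577903684785153411658710858027777474450*q*z*t -
        11829662469357357319778758610307075332856256234830549016407823828740*q*z -
        150705028222427892625199493794616090213055067135979728942331192000*q*t^2 -
        29346603607878588697957603907623907520616226043011249405909156152200*q*t -
        74781349122107378070732600434408648617925267593713796515931155438180*q -
        1041533157839694826822148459525341536069362099915030942615464958910*z^2*t +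
        11862435261115423921182661124868142323848149113078474701762750940*z^2 +
        1775492308017967993703989778864560424140557450535459818884159188440*z*t^2 +
        11385502613715446071639510657967806201868814857334206907497063356710*z*t +
        21744192794932853682194851607116825107175155265640752128678476506980*z +
        33198240656773336635082852595296932152238867762820638551769456000*t^3 +
        9094970165860950029046034835138825216510607058993456052538937754400*t^2 +
        46829403962430289658847734792755543874033001743171784834077138389530*t +
        62116011571030038136182807428599942249660645572925893101548437660810) * h0
  exact (mul_eq_zero.mp key).resolve_left (by norm_num)

/-- Groebner basis obstruction in Case (VII): the polynomial `p·t⁴` lies in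
the ideal generated by `E₀, E₂, E₃, E₄, E₅, E₆`, hence any common zero
satisfies `p·t⁴ = 0`, i.e. `p = 0` or `t = 0`. -/
theorem case_VII_groebner_obstruction
    (A B u p t : ℝ)
    (hE0 : B * (B + p * u + t + t ^ 2) ^ 2 + A * p ^ 2 * (B + t ^ 2) - A * B = 0)
    (hE2 : 2 * B * p + 2 * p * t ^ 2 + 2 * p * t + 3 * t * u + 2 * u = 0)
    (hE3 : 3 * A + 2 * B * p ^ 2 + 2 * B * t + 2 * B + 2 * p ^ 2 * t ^ 2
      + 10 * p * t * u + 4 * p * u + 2 * t ^ 3 + 7 * t ^ 2 + 4 * t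
      + 3 * u ^ 2 = 0)
    (hE4 : 8 * A * p + 5 * B * p * t + 4 * B * p + B * u + 7 * p ^ 2 * t * u
      + 5 * p * t ^ 3 + 14 * p * t ^ 2 + 4 * p * t + 8 * p * u ^ 2
      + 8 * t ^ 2 * u + 17 * t * u + 4 * u = 0)
    (hE5 : 15 * A * p ^ 2 + 15 * A * t + 15 * A + 10 * B * p ^ 2 * t
      + 4 * B * p ^ 2 + 8 * B * p * u + 5 * B * t ^ 2 + 10 * B * t + 4 * B
      + 10 * p ^ 2 * t ^ 3 + 21 * p ^ 2 * t ^ 2 + 15 * p ^ 2 * u ^ 2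
      + 53 * p * t ^ 2 * u + 92 * p * t * u + 8 * p * u + 5 * t ^ 4
      + 27 * t ^ 3 + 35 * t ^ 2 + 24 * t * u ^ 2 + 8 * t + 25 * u ^ 2 = 0)
    (hE6 : 120 * A * p * t + 96 * A * p + 24 * A * u + 10 * B * p ^ 3 * t
      + 26 * B * p ^ 2 * u + 40 * B * p * t ^ 2 + 66 * B * p * t + 16 * B * p
      + 18 * B * t * u + 18 * B * u + 10 * p ^ 3 * t ^ 3
      + 136 * p ^ 2 * t ^ 2 * u + 164 * p ^ 2 * t * u + 40 * p * t ^ 4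
      + 196 * p * t ^ 3 + 204 * p * t ^ 2 + 208 * p * t * u ^ 2 + 16 * p * t
      + 172 * p * u ^ 2 + 73 * t ^ 3 * u + 274 * t ^ 2 * u + 220 * t * u
      + 24 * u ^ 3 + 16 * u = 0) :
    p * t ^ 4 = 0 ∧ (p = 0 ∨ t = 0) := by
  have main : p = 0 ∨ t = 0 := by
    by_contra! hne
    obtain ⟨hp, ht⟩ := hne
    obtain ⟨z, rfl⟩ : ∃ z, u = p * z * t := ⟨u / (p * t), by field_simp⟩
    have hB : B = -t ^ 2 - t - (3 * t + 2) * (z * t) / 2 := by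
      have h : p * (B - (-t ^ 2 - t - (3 * t + 2) * (z * t) / 2)) = 0 := by
        linear_combination (1 / 2) * hE2
      exact sub_eq_zero.mp ((mul_eq_zero.mp h).resolve_left hp)
    subst hB
    have h4 : -70*(p^2)*z*t - 32*(p^2)*z + 32*(p^2) - 9*z^2*t^2 - 6*z^2*t + 45*z*t^2 + 110*z*t + 32*z - 18*t -
        32 = 0 := by
      have h : (p * t ^ 1) * (-70*(p^2)*z*t - 32*(p^2)*z + 32*(p^2) - 9*z^2*t^2 - 6*z^2*t + 45*z*t^2 + 110*z*t + 32*z - 18*t -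
        32) = 0 := by
        linear_combination (6) * hE4 - (6) * 8 / 3 * p * hE3
      exact (mul_eq_zero.mp h).resolve_left (by positivity)
    have h6 : -7*(p^2)*z^2*t + 34*(p^2)*z^2 - 185*(p^2)*z*t - 20*(p^2)*z + 70*(p^2) - 3*z^2*t^2 + 13*z^2*t +
        10*z^2 + 115*z*t^2 + 281*z*t + 116*z - 30*t - 18 = 0 := by
      have h : (p * t ^ 2) * (-7*(p^2)*z^2*t + 34*(p^2)*z^2 - 185*(p^2)*z*t - 20*(p^2)*z + 70*(p^2) - 3*z^2*t^2 + 13*z^2*t +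
        10*z^2 + 115*z*t^2 + 281*z*t + 116*z - 30*t - 18) = 0 := by
        linear_combination (1) * ((1) * (hE6 - (40 * t + 32 + 8 * z * t) * p * hE3)
          - 2 * p * t ^ 1 * h4)
      exact (mul_eq_zero.mp h).resolve_left (by positivity)
    have h5 : -210*(p^2)^2*z - 3*(p^2)*z^2*t + 62*(p^2)*z^2 - 65*(p^2)*z*t + 428*(p^2)*z + 122*(p^2) +
        27*z^2*t + 18*z^2 + 120*z*t^2 + 185*z*t - 26*z - 48*t - 10 = 0 := by
      have h : (t ^ 2) * (-210*(p^2)^2*z - 3*(p^2)*z^2*t + 62*(p^2)*z^2 - 65*(p^2)*z*t + 428*(p^2)*z + 122*(p^2) +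
        27*z^2*t + 18*z^2 + 120*z*t^2 + 185*z*t - 26*z - 48*t - 10) = 0 := by
        linear_combination (8) * ((2) * (hE5 - (5 * p ^ 2 + 5 * t + 5) * hE3)
          - t ^ 1 * (5 * p ^ 2 + 3) / 8 * h4)
      exact (mul_eq_zero.mp h).resolve_left (by positivity)
    have h0 : 120*(p^2)^2*z^2*t + 90*(p^2)^2*z^2 - 6*(p^2)^2*z + 216*(p^2)*z^3*t^2 + 207*(p^2)*z^3*t +
        42*(p^2)*z^3 + 72*(p^2)*z^2*t^2 - 108*(p^2)*z^2*t - 66*(p^2)*z^2 - 43*(p^2)*z*t +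
        82*(p^2)*z + 62*(p^2) - 162*z^3*t^3 - 324*z^3*t^2 - 207*z^3*t - 42*z^3 - 108*z^2*t^3 -
        180*z^2*t^2 - 60*z^2*t - 24*z^2 + 48*z*t^2 + 11*z*t - 76*z - 48*t - 62 = 0 := by
      have h : (t ^ 3) * (120*(p^2)^2*z^2*t + 90*(p^2)^2*z^2 - 6*(p^2)^2*z + 216*(p^2)*z^3*t^2 + 207*(p^2)*z^3*t +
        42*(p^2)*z^3 + 72*(p^2)*z^2*t^2 - 108*(p^2)*z^2*t - 66*(p^2)*z^2 - 43*(p^2)*z*t +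
        82*(p^2)*z + 62*(p^2) - 162*z^3*t^3 - 324*z^3*t^2 - 207*z^3*t - 42*z^3 - 108*z^2*t^3 -
        180*z^2*t^2 - 60*z^2*t - 24*z^2 + 48*z*t^2 + 11*z*t - 76*z - 48*t - 62) = 0 := by
        linear_combination (2) * ((24) * (hE0 - (1 / 3) *
          (p ^ 2 * (-t - (3 * t + 2) * (z * t) / 2)
            - (-t ^ 2 - t - (3 * t + 2) * (z * t) / 2)) * hE3)
          + t ^ 2 * (z + 1) * (p ^ 2 - 1) / 2 * h4)
      exact (mul_eq_zero.mp h).resolve_left (by positivity)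
    exact ht (reduced_aux (p ^ 2) z t h4 h6 h5 h0)
  refine ⟨?_, main⟩
  rcases main with h | h <;> simp [h]
end
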